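/- arXiv:1306.3638 — 2 statements merged into one kernel-verified Lean document; each statement's English description precedes it below -/
import Mathlib

section
/- Let v, x, w, h ∈ ℝⁿ with v·x = 0, |w − v| ≤ |v|/(4√2), |h| < 1 + |x|/√2, and 2⁵ n max(β^l_1, β^l_2) ≤ α |v|² (1 + |x|/√2 − |h|)^α. Then for every h′ ∈ ℝⁿ with |h′| ≤ |h|, every t ≥ 0, and every η ∈ (0,1): |z_+(w,x+h,t) − z_+(w,x+h′,t)| ≤ 2|h − h′| and |η z_+(w,x+h′,t) + (1−η) z_+(w,x+h,t)| ≥ |x|/√2 − |h| + t|v|/(2√2). -/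
open MeasureTheory Real Filter Set Topology RealInnerProductSpace

noncomputable section

namespace Paper

/-- ℝⁿ -/
abbrev Euc (n : ℕ) : Type := EuclideanSpace ℝ (Fin n)

variable {n : ℕ}

/-- the norm `sup_{t ≤ 0} ‖f t‖ + sup_{t ≥ 0} ‖f t‖/(1+t)` on the space `M_r`. -/
def Mnorm (f : ℝ → Euc n) : ℝ :=
  sSup ((fun t => ‖f t‖) '' Iic 0) + sSup ((fun t => ‖f t‖ / (1 + t)) '' Ici 0)

/-- membership in the complete metric space `M_r`. -/
def MemM (r : ℝ) (f : ℝ → Euc n) : Prop :=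
  Continuous f ∧ BddAbove ((fun t => ‖f t‖) '' Iic 0) ∧
    BddAbove ((fun t => ‖f t‖ / (1 + t)) '' Ici 0) ∧ Mnorm f ≤ r

/-- the long range decay conditions on `V^l`. -/
def LongRange (α βl0 βl1 βl2 : ℝ) (Vl : Euc n → ℝ) : Prop :=
  ContDiff ℝ 2 Vl ∧
    (∀ x, |Vl x| ≤ βl0 * (1 + ‖x‖) ^ (-α)) ∧
    (∀ x, ‖gradient Vl x‖ ≤ βl1 * (1 + ‖x‖) ^ (-(α + 1))) ∧
    (∀ x, ‖iteratedFDeriv ℝ 2 Vl x‖ ≤ βl2 * (1 + ‖x‖) ^ (-(α + 2)))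

/-- the short range decay conditions on `V^s`. -/
def ShortRange (α βs1 βs2 βs3 : ℝ) (Vs : Euc n → ℝ) : Prop :=
  ContDiff ℝ 2 Vs ∧
    (∀ x, |Vs x| ≤ βs1 * (1 + ‖x‖) ^ (-(α + 1))) ∧
    (∀ x, ‖gradient Vs x‖ ≤ βs2 * (1 + ‖x‖) ^ (-(α + 2))) ∧
    (∀ x, ‖iteratedFDeriv ℝ 2 Vs x‖ ≤ βs3 * (1 + ‖x‖) ^ (-(α + 3)))

/-- `z` is a C² solution of `z'' = Fl ∘ z` with `z 0 = x0`, `z' → w` along the filter `l`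
(`atBot` for `z_-`, `atTop` for `z_+`), satisfying the growth bound `‖z t - x0 - t w‖ ≤ C |t|`. -/
def IsFreeSol (Fl : Euc n → Euc n) (x0 w : Euc n) (l : Filter ℝ) (C : ℝ)
    (z : ℝ → Euc n) : Prop :=
  ContDiff ℝ 2 z ∧ (∀ t, deriv (deriv z) t = Fl (z t)) ∧ z 0 = x0 ∧
    Tendsto (fun t => deriv z t) l (𝓝 w) ∧ ∀ t, ‖z t - x0 - t • w‖ ≤ C * |t|

/-- the map `A` (or `𝒜` when `xm = 0` and `zm` already contains the base point). -/
def Aop (Fl F : Euc n → Euc n) (zm : ℝ → Euc n) (xm : Euc n)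
    (f : ℝ → Euc n) (t : ℝ) : Euc n :=
  ∫ σ in Iic t, ∫ τ in Iic σ, (F (zm τ + xm + f τ) - Fl (zm τ))

/-- the vector `l(v_-,x_-,y_-)`. -/
def lInt (Fl Fs F : Euc n → Euc n) (zm : ℝ → Euc n) (xm : Euc n) (ym : ℝ → Euc n) : Euc n :=
  (∫ σ in Iic (0:ℝ), ∫ τ in Iic σ, (F (zm τ + xm + ym τ) - Fl (zm τ))) -
    ∫ σ in Ici (0:ℝ), ∫ τ in Ici σ, Fs (zm τ + xm + ym τ)

/-- the vector `l₁(v_-,x_-)`. -/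
def l1Int (Fl : Euc n → Euc n) (zp : ℝ → Euc n) (xm : Euc n) : Euc n :=
  -∫ σ in Ici (0:ℝ), ∫ τ in Ici σ, (Fl (zp τ + xm) - Fl (zp τ))

/-- the vector `l₂(v_-,x_-,y_-)`. -/
def l2Int (Fl : Euc n → Euc n) (zm zp : ℝ → Euc n) (xm : Euc n) (ym : ℝ → Euc n) : Euc n :=
  -∫ σ in Ici (0:ℝ), ∫ τ in Ici σ, (Fl (zm τ + xm + ym τ) - Fl (zp τ + xm))

/-- the function `y_+`. -/
def yplusInt (Fl F : Euc n → Euc n) (zm zp : ℝ → Euc n) (xm : Euc n) (ym : ℝ → Euc n)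
    (t : ℝ) : Euc n :=
  ∫ σ in Ici t, ∫ τ in Ici σ, (F (zm τ + xm + ym τ) - Fl (zp τ))

/-- the vector `W(v_-,x_-)`. -/
def Wvec (Fl : Euc n → Euc n) (zm zp : ℝ → Euc n) (xm : Euc n) : Euc n :=
  (∫ σ in Iic (0:ℝ), ∫ τ in Iic σ, (Fl (zm τ + xm) - Fl (zm τ))) -
    ∫ σ in Ici (0:ℝ), ∫ τ in Ici σ, (Fl (zp τ + xm) - Fl (zp τ))

/-- the map `𝒢_{v_-,x_-}`; here `zm = z_-(v_-,x_-,·)` contains the base point `x_-`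
and `zp h = z_+(ã, x_- + h, ·)`. -/
def Gmap (Fl Fs F : Euc n → Euc n) (zm : ℝ → Euc n) (zp : Euc n → ℝ → Euc n)
    (ym : ℝ → Euc n) (h : Euc n) : Euc n :=
  lInt Fl Fs F zm 0 ym -
    ∫ σ in Ici (0:ℝ), ∫ τ in Ici σ, (Fl (zm τ + ym τ) - Fl (zp h τ))

/-- the vector `W̃(v_-,x_-)`; here `zp0 = z_+(ã, x_-, ·)`. -/
def Wtilde (Fl : Euc n → Euc n) (zm zp0 : ℝ → Euc n) : Euc n :=
  (∫ τ in Iic (0:ℝ), Fl (zm τ)) + ∫ τ in Ici (0:ℝ), Fl (zp0 τ)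

/-- A curve that vanishes at infinity is bounded by any nonnegative `g` whose decay rate
dominates its speed. -/
lemma norm_le_of_norm_deriv_le_neg_deriv {E : Type*} [NormedAddCommGroup E] [NormedSpace ℝ E]
    {f f' : ℝ → E} {g g' : ℝ → ℝ} (hf : ∀ t, HasDerivAt f (f' t) t)
    (hg : ∀ t, 0 ≤ t → HasDerivAt g (g' t) t) (hfg : ∀ t, 0 ≤ t → ‖f' t‖ ≤ -g' t)
    (hg0 : ∀ t, 0 ≤ t → 0 ≤ g t) (hlim : Tendsto f atTop (𝓝 0)) {t : ℝ} (ht : 0 ≤ t) :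
    ‖f t‖ ≤ g t := by
  have key : ∀ T, t ≤ T → ‖f T - f t‖ ≤ g t := by
    intro T hT
    have h1 := image_norm_le_of_norm_deriv_right_le_deriv_boundary' (a := t) (b := T)
      (f := fun s => f s - f t) (f' := f') (B := fun s => g t - g s) (B' := fun s => -g' s)
      (fun s _ => ((hf s).sub_const _).continuousAt.continuousWithinAt)
      (fun s _ => ((hf s).sub_const _).hasDerivWithinAt)
      (by simp)
      (fun s hs => ((hg s (ht.trans hs.1)).const_sub _).continuousAt.continuousWithinAt)
      (fun s hs => ((hg s (ht.trans hs.1)).const_sub _).hasDerivWithinAt)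
      (fun s hs => hfg s (ht.trans hs.1)) (right_mem_Icc.2 hT)
    have h2 := hg0 T (ht.trans hT)
    linarith
  have hl : Tendsto (fun T => ‖f T - f t‖) atTop (𝓝 ‖0 - f t‖) := (hlim.sub_const _).norm
  have := le_of_tendsto hl ((eventually_ge_atTop t).mono key)
  simpa using this

lemma norm_sub_le_of_norm_deriv_le {E : Type*} [NormedAddCommGroup E] [NormedSpace ℝ E]
    {f f' : ℝ → E} {B B' : ℝ → ℝ} (hf : ∀ t, HasDerivAt f (f' t) t)
    (hB : ∀ t, 0 ≤ t → HasDerivAt B (B' t) t) (hfB : ∀ t, 0 ≤ t → ‖f' t‖ ≤ B' t)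
    {t : ℝ} (ht : 0 ≤ t) : ‖f t - f 0‖ ≤ B t - B 0 :=
  image_norm_le_of_norm_deriv_right_le_deriv_boundary' (a := 0) (b := t)
    (f := fun s => f s - f 0) (f' := f') (B := fun s => B s - B 0) (B' := B')
    (fun s _ => ((hf s).sub_const _).continuousAt.continuousWithinAt)
    (fun s _ => ((hf s).sub_const _).hasDerivWithinAt)
    (by simp)
    (fun s hs => ((hB s hs.1).sub_const _).continuousAt.continuousWithinAt)
    (fun s hs => ((hB s hs.1).sub_const _).hasDerivWithinAt)
    (fun s hs => hfB s hs.1) (right_mem_Icc.2 ht)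

lemma hasDerivAt_affine_rpow {a k : ℝ} (ha : 0 < a) (hk : 0 < k) (p : ℝ) {t : ℝ} (ht : 0 ≤ t) :
    HasDerivAt (fun s => (a + k * s) ^ p) (k * p * (a + k * t) ^ (p - 1)) t := by
  have h1 : HasDerivAt (fun s : ℝ => a + k * s) k t := by
    simpa using ((hasDerivAt_id t).const_mul k).const_add a
  have hpos : 0 < a + k * t := by positivity
  exact h1.rpow_const (Or.inl hpos.ne')

/-- One step of the a priori estimate for the difference of two solutions: an affine bound on
`δ` is improved by the decay of `δ''` along the trajectories. -/
lemma norm_le_affine_of_norm_deriv2_le {E : Type*} [NormedAddCommGroup E] [NormedSpace ℝ E]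
    {δ δ' δ'' : ℝ → E} {a k α β P Q : ℝ} (ha : 0 < a) (hk : 0 < k) (hα : 0 < α)
    (hβ : 0 ≤ β) (hP : 0 ≤ P) (hQ : 0 ≤ Q) (hβk : 2 * β ≤ α * k ^ 2 * a ^ α)
    (h1 : ∀ t, HasDerivAt δ (δ' t) t) (h2 : ∀ t, HasDerivAt δ' (δ'' t) t)
    (hlim : Tendsto δ' atTop (𝓝 0))
    (hδ'' : ∀ t, 0 ≤ t → ‖δ'' t‖ ≤ β * (a + k * t) ^ (-(α + 2)) * ‖δ t‖)
    (hδ : ∀ t, 0 ≤ t → ‖δ t‖ ≤ P + Q * (a + k * t)) {t : ℝ} (ht : 0 ≤ t) :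
    ‖δ t‖ ≤ ‖δ 0‖ + P / 2 + Q / 2 * (a + k * t) := by
  have hder : ∀ p s : ℝ, 0 ≤ s → _ := fun p s hs => hasDerivAt_affine_rpow ha hk p (t := s) hs
  have hv : ∀ t, 0 ≤ t → ‖δ' t‖ ≤
      β * P / k * (a + k * t) ^ (-(α + 1)) + β * Q / (α * k) * (a + k * t) ^ (-α) := by
    intro t ht
    refine norm_le_of_norm_deriv_le_neg_deriv h2
      (fun s hs => ((hder (-(α + 1)) s hs).const_mul (β * P / k)).add
        ((hder (-α) s hs).const_mul (β * Q / (α * k)))) ?_ ?_ hlim ht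
    · intro s hs
      have hpos : 0 < a + k * s := by positivity
      have e1 : -(α + 1) - 1 = -(α + 2) := by ring
      have e2 : (a + k * s) ^ (-(α + 2)) * (a + k * s) = (a + k * s) ^ (-α - 1) := by
        rw [← Real.rpow_add_one hpos.ne']; congr 1; ring
      have hX : 0 ≤ (a + k * s) ^ (-(α + 2)) := by positivity
      rw [e1, ← e2]
      set X := (a + k * s) ^ (-(α + 2))
      have e3 : -(β * P / k * (k * -(α + 1) * X) + β * Q / (α * k) * (k * -α * (X * (a + k * s))))
          = β * X * (P + Q * (a + k * s)) + α * (β * P * X) := by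
        field_simp
        ring
      rw [e3]
      have h3 := mul_le_mul_of_nonneg_left (hδ s hs) (mul_nonneg hβ hX)
      have h4 : 0 ≤ α * (β * P * X) := by positivity
      linarith [hδ'' s hs]
    · intro s hs
      have hpos : 0 < a + k * s := by positivity
      change 0 ≤ β * P / k * (a + k * s) ^ (-(α + 1)) + β * Q / (α * k) * (a + k * s) ^ (-α)
      positivity
  have hd := norm_sub_le_of_norm_deriv_le h1
    (B := fun s => β * P / k * (-(1 / (α * k))) * (a + k * s) ^ (-α)
      + β * Q / (α * k) * a ^ (-α) * s)
    (fun s hs => ((hder (-α) s hs).const_mul _).add ((hasDerivAt_id s).const_mul _)) ?_ ht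
  · have hpos : 0 < a + k * t := by positivity
    have hb : 2 * (β * a ^ (-α)) ≤ α * k ^ 2 := by
      rw [Real.rpow_neg ha.le, ← div_eq_mul_inv, mul_div_assoc', div_le_iff₀ (by positivity)]
      exact hβk
    have hX : 0 ≤ (a + k * t) ^ (-α) := by positivity
    have hA : 0 ≤ a ^ (-α) := by positivity
    have hb' : β * a ^ (-α) / (α * k ^ 2) ≤ 1 / 2 := by
      rw [div_le_iff₀ (by positivity)]; linarith
    have e : (β * P / k * (-(1 / (α * k))) * (a + k * t) ^ (-α) + β * Q / (α * k) * a ^ (-α) * t)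
        - (β * P / k * (-(1 / (α * k))) * (a + k * 0) ^ (-α) + β * Q / (α * k) * a ^ (-α) * 0)
        = β * a ^ (-α) / (α * k ^ 2) * (P + Q * (k * t))
          - β * P / (α * k ^ 2) * (a + k * t) ^ (-α) := by
      rw [mul_zero k, add_zero]
      field_simp
      ring
    rw [e] at hd
    have h5 : 0 ≤ β * P / (α * k ^ 2) * (a + k * t) ^ (-α) := by positivity
    have h6 := mul_le_mul_of_nonneg_right hb' (show 0 ≤ P + Q * (k * t) by positivity)
    have h7 : ‖δ t‖ ≤ ‖δ t - δ 0‖ + ‖δ 0‖ := by simpa using norm_add_le (δ t - δ 0) (δ 0)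
    have h8 : 0 ≤ Q * a := by positivity
    linarith
  · intro s hs
    have hpos : 0 < a + k * s := by positivity
    refine (hv s hs).trans ?_
    have e1 : -α - 1 = -(α + 1) := by ring
    have h3 : (a + k * s) ^ (-α) ≤ a ^ (-α) :=
      Real.rpow_le_rpow_of_nonpos ha (by nlinarith) (by linarith)
    have h4 : β * P / k * (-(1 / (α * k))) * (k * -α * (a + k * s) ^ (-α - 1)) =
        β * P / k * (a + k * s) ^ (-(α + 1)) := by
      rw [e1]; field_simp
    rw [h4, mul_one]
    gcongr

lemma norm_le_two_mul_of_norm_deriv2_le {E : Type*} [NormedAddCommGroup E] [NormedSpace ℝ E]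
    {δ δ' δ'' : ℝ → E} {a k α β c : ℝ} (ha : 0 < a) (hk : 0 < k) (hα : 0 < α)
    (hβ : 0 ≤ β) (hc : 0 ≤ c) (hβk : 2 * β ≤ α * k ^ 2 * a ^ α)
    (h1 : ∀ t, HasDerivAt δ (δ' t) t) (h2 : ∀ t, HasDerivAt δ' (δ'' t) t)
    (hlim : Tendsto δ' atTop (𝓝 0))
    (hδ'' : ∀ t, 0 ≤ t → ‖δ'' t‖ ≤ β * (a + k * t) ^ (-(α + 2)) * ‖δ t‖)
    (hδ : ∀ t, 0 ≤ t → ‖δ t‖ ≤ ‖δ 0‖ + c * t) {t : ℝ} (ht : 0 ≤ t) :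
    ‖δ t‖ ≤ 2 * ‖δ 0‖ := by
  have key : ∀ m : ℕ, ∀ t, 0 ≤ t → ‖δ t‖ ≤ 2 * ‖δ 0‖ + c / k * (1 / 2) ^ m * (a + k * t) := by
    intro m
    induction m with
    | zero =>
      intro t ht
      have e : c / k * (a + k * t) = c / k * a + c * t := by field_simp
      have h3 : 0 ≤ c / k * a := by positivity
      rw [pow_zero, mul_one, e]
      linarith [hδ t ht, norm_nonneg (δ 0)]
    | succ m ih =>
      intro t ht
      have := norm_le_affine_of_norm_deriv2_le ha hk hα hβ (by positivity)
        (by positivity : 0 ≤ c / k * (1 / 2) ^ m) hβk h1 h2 hlim hδ'' ih ht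
      rw [pow_succ]
      linarith
  have hp : Tendsto (fun m : ℕ => 2 * ‖δ 0‖ + c / k * (1 / 2) ^ m * (a + k * t)) atTop
      (𝓝 (2 * ‖δ 0‖ + c / k * 0 * (a + k * t))) :=
    (((tendsto_pow_atTop_nhds_zero_of_lt_one (by norm_num) (by norm_num)).const_mul
      _).mul_const _).const_add _
  have := ge_of_tendsto' hp fun m => key m t ht
  simpa using this

lemma norm_gradient_sub_le {E : Type*} [NormedAddCommGroup E] [InnerProductSpace ℝ E]
    [CompleteSpace E] {V : E → ℝ} (hV : ContDiff ℝ 2 V) {y z : E} {C : ℝ}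
    (hC : ∀ u ∈ segment ℝ y z, ‖iteratedFDeriv ℝ 2 V u‖ ≤ C) :
    ‖gradient V z - gradient V y‖ ≤ C * ‖z - y‖ := by
  have hd : Differentiable ℝ (fderiv ℝ V) :=
    (hV.fderiv_right (m := 1) (by norm_num)).differentiable (by norm_num)
  have h1 : ‖gradient V z - gradient V y‖ = ‖fderiv ℝ V z - fderiv ℝ V y‖ := by
    rw [gradient, gradient, ← map_sub, LinearIsometryEquiv.norm_map]
  rw [h1]
  refine (convex_segment y z).norm_image_sub_le_of_norm_fderiv_le (fun u _ => hd u)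
    (fun u hu => ?_) (left_mem_segment ℝ y z) (right_mem_segment ℝ y z)
  refine le_trans (le_of_eq ?_) (hC u hu)
  have h2 : ‖iteratedFDeriv ℝ 1 (fderiv ℝ V) u‖ = ‖iteratedFDeriv ℝ 2 V u‖ :=
    norm_iteratedFDeriv_fderiv
  rw [← h2, norm_iteratedFDeriv_one]

lemma norm_add_smul_ge_of_inner_eq_zero {E : Type*} [NormedAddCommGroup E]
    [InnerProductSpace ℝ E] {v x : E} (hvx : ⟪v, x⟫ = 0) {t : ℝ} (ht : 0 ≤ t) :
    ‖x‖ / √2 + t * ‖v‖ / √2 ≤ ‖x + t • v‖ := by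
  have hs : (0 : ℝ) < √2 := by positivity
  rw [← add_div, div_le_iff₀ hs]
  refine abs_le_of_sq_le_sq' ?_ (by positivity) |>.2
  rw [mul_pow, Real.sq_sqrt (by norm_num), norm_add_sq_real, inner_smul_right, real_inner_comm,
    hvx, norm_smul, Real.norm_of_nonneg ht]
  nlinarith [sq_nonneg (‖x‖ - t * ‖v‖)]

lemma growth_constant_le {n : ℕ} (hn : 2 ≤ n) {α β ρ A : ℝ} (hα : 0 < α) (hβ : 0 ≤ β)
    (hρ : 0 < ρ) (hA : 0 < A) (h : 2 ^ 5 * (n : ℝ) * β ≤ α * ρ ^ 2 * A) :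
    2 ^ ((5 : ℝ) / 2) * √n * β / (α * ρ * A) ≤ ρ / (4 * √2) := by
  have hs : √2 ^ 2 = (2 : ℝ) := Real.sq_sqrt (by norm_num)
  have h2 : (2 : ℝ) ^ ((5 : ℝ) / 2) = 4 * √2 := by
    rw [show (5 : ℝ) / 2 = 2 + 1 / 2 by norm_num, Real.rpow_add (by norm_num),
      ← Real.sqrt_eq_rpow]
    norm_num
  have hn1 : (1 : ℝ) ≤ n := by exact_mod_cast (by omega : 1 ≤ n)
  have hsn : √(n : ℝ) ≤ n := Real.sqrt_le_left (by linarith) |>.2 (by nlinarith)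
  rw [h2, div_le_div_iff₀ (by positivity) (by positivity)]
  have h3 := mul_le_mul_of_nonneg_right hsn hβ
  calc 4 * √2 * √n * β * (4 * √2) = 16 * √2 ^ 2 * (√n * β) := by ring
    _ ≤ ρ * (α * ρ * A) := by rw [hs]; linarith

theorem statement_15
    (n : ℕ) (hn : 2 ≤ n) (α : ℝ) (hα0 : 0 < α) (hα1 : α ≤ 1)
    (Vl Vs : Euc n → ℝ) (βl0 βl1 βl2 βs1 βs2 βs3 : ℝ)
    (hβl0 : 0 < βl0) (hβl1 : 0 < βl1) (hβl2 : 0 < βl2)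
    (hβs1 : 0 < βs1) (hβs2 : 0 < βs2) (hβs3 : 0 < βs3)
    (hVl : LongRange α βl0 βl1 βl2 Vl) (hVs : ShortRange α βs1 βs2 βs3 Vs)
    (Fl Fs F : Euc n → Euc n)
    (hFl : ∀ y, Fl y = -gradient Vl y) (hFs : ∀ y, Fs y = -gradient Vs y)
    (hF : ∀ y, F y = Fl y + Fs y)
    (v x w h h' : Euc n) (hperp : ⟪v, x⟫ = 0)
    (hw : ‖w - v‖ ≤ ‖v‖ / (4 * Real.sqrt 2))
    (hh : ‖h‖ < 1 + ‖x‖ / Real.sqrt 2)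
    (hcond : 2 ^ 5 * (n : ℝ) * max βl1 βl2 ≤
      α * ‖v‖ ^ 2 * (1 + ‖x‖ / Real.sqrt 2 - ‖h‖) ^ α)
    (hh' : ‖h'‖ ≤ ‖h‖)
    (zp zp' : ℝ → Euc n)
    (hzp : IsFreeSol Fl (x + h) w atTop
      (2 ^ ((5:ℝ)/2) * Real.sqrt n * βl1 /
        (α * ‖v‖ * (1 + ‖x‖ / Real.sqrt 2 - ‖h‖) ^ α)) zp)
    (hzp' : IsFreeSol Fl (x + h') w atTop
      (2 ^ ((5:ℝ)/2) * Real.sqrt n * βl1 /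
        (α * ‖v‖ * (1 + ‖x‖ / Real.sqrt 2 - ‖h'‖) ^ α)) zp') :
    ∀ t : ℝ, 0 ≤ t →
      ‖zp t - zp' t‖ ≤ 2 * ‖h - h'‖ ∧
      ∀ η : ℝ, 0 < η → η < 1 →
        ‖x‖ / Real.sqrt 2 - ‖h‖ + t * ‖v‖ / (2 * Real.sqrt 2) ≤
          ‖η • zp' t + (1 - η) • zp t‖ := by
  have hs0 : (0 : ℝ) < √2 := by positivity
  have hs2 : √2 ^ 2 = (2 : ℝ) := Real.sq_sqrt (by norm_num)
  have hn1 : (1 : ℝ) ≤ n := by exact_mod_cast (by omega : 1 ≤ n)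
  have hv : 0 < ‖v‖ := by
    rcases (norm_nonneg v).eq_or_lt with h0 | h0
    · rw [← h0] at hcond
      have : 0 < 2 ^ 5 * (n : ℝ) * max βl1 βl2 := by positivity
      simp only [ne_eq, OfNat.ofNat_ne_zero, not_false_eq_true, zero_pow, mul_zero,
        zero_mul] at hcond
      linarith
    · exact h0
  set a := 1 + ‖x‖ / √2 - ‖h‖ with ha_def
  have ha : 0 < a := by linarith
  have haα : 0 < a ^ α := by positivity
  set C := ‖v‖ / (4 * √2) with hC
  have hC0 : 0 ≤ C := by positivity
  have hgrow : ∀ h₀ : Euc n, ‖h₀‖ ≤ ‖h‖ → ∀ z : ℝ → Euc n,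
      IsFreeSol Fl (x + h₀) w atTop (2 ^ ((5:ℝ)/2) * √n * βl1 /
        (α * ‖v‖ * (1 + ‖x‖ / √2 - ‖h₀‖) ^ α)) z →
      ∀ t, 0 ≤ t → ‖z t - (x + h₀) - t • w‖ ≤ C * t := by
    intro h₀ hh₀ z hz t ht
    have haa : a ^ α ≤ (1 + ‖x‖ / √2 - ‖h₀‖) ^ α :=
      Real.rpow_le_rpow ha.le (by linarith) hα0.le
    have hle := growth_constant_le (n := n) hn hα0 hβl1.le hv (haα.trans_le haa) (by
      calc 2 ^ 5 * (n : ℝ) * βl1 ≤ 2 ^ 5 * (n : ℝ) * max βl1 βl2 := by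
            gcongr; exact le_max_left _ _
        _ ≤ _ := hcond
        _ ≤ _ := by gcongr)
    have hz5 := hz.2.2.2.2 t
    rw [abs_of_nonneg ht] at hz5
    exact hz5.trans (mul_le_mul_of_nonneg_right hle ht)
  have hg := hgrow h le_rfl zp hzp
  have hg' := hgrow h' hh' zp' hzp'
  have hlow : ∀ t, 0 ≤ t → ∀ η ζ : ℝ, 0 ≤ η → 0 ≤ ζ → η + ζ = 1 →
      ‖x‖ / √2 - ‖h‖ + t * ‖v‖ / (2 * √2) ≤ ‖η • zp' t + ζ • zp t‖ := by
    intro t ht η ζ hη hζ hηζ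
    have e : η • zp' t + ζ • zp t = (x + t • v) + (η • (h' + (zp' t - (x + h') - t • w))
        + ζ • (h + (zp t - (x + h) - t • w)) + t • (w - v)) := by
      obtain rfl : ζ = 1 - η := by linarith
      module
    have hb : ∀ h₀ p : Euc n, ‖h₀‖ ≤ ‖h‖ → ‖p‖ ≤ C * t → ‖h₀ + p‖ ≤ ‖h‖ + C * t :=
      fun h₀ p h1 h2 => (norm_add_le _ _).trans (add_le_add h1 h2)
    have herr : ‖η • (h' + (zp' t - (x + h') - t • w))
        + ζ • (h + (zp t - (x + h) - t • w)) + t • (w - v)‖ ≤ ‖h‖ + C * t + C * t := by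
      refine (norm_add_le _ _).trans (add_le_add ((norm_add_le _ _).trans ?_) ?_)
      · rw [norm_smul, norm_smul, Real.norm_of_nonneg hη, Real.norm_of_nonneg hζ]
        calc _ ≤ η * (‖h‖ + C * t) + ζ * (‖h‖ + C * t) := by
              gcongr
              · exact hb _ _ hh' (hg' t ht)
              · exact hb _ _ le_rfl (hg t ht)
          _ = ‖h‖ + C * t := by rw [← add_mul, hηζ, one_mul]
      · rw [norm_smul, Real.norm_of_nonneg ht, mul_comm]
        gcongr
    have hmain := norm_add_smul_ge_of_inner_eq_zero hperp ht
    have htri := norm_sub_le_norm_add (x + t • v) (η • (h' + (zp' t - (x + h') - t • w))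
        + ζ • (h + (zp t - (x + h) - t • w)) + t • (w - v))
    rw [← e] at htri
    have e2 : C * t + C * t = t * ‖v‖ / √2 - t * ‖v‖ / (2 * √2) := by
      rw [hC]; field_simp; ring
    linarith
  set k := ‖v‖ / (2 * √2) with hk
  have hk0 : 0 < k := by positivity
  have hksq : k ^ 2 = ‖v‖ ^ 2 / 8 := by
    rw [hk, div_pow, mul_pow, hs2]; norm_num
  obtain ⟨hz1, hz2, hz3, hz4, -⟩ := hzp
  obtain ⟨hz1', hz2', hz3', hz4', -⟩ := hzp'
  have hder : ∀ z : ℝ → Euc n, ContDiff ℝ 2 z → (∀ t, HasDerivAt z (deriv z t) t) ∧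
      ∀ t, HasDerivAt (deriv z) (deriv (deriv z) t) t := by
    intro z hz
    have hd : ContDiff ℝ 1 (deriv z) := by
      rw [show (2 : WithTop ℕ∞) = 1 + 1 by norm_num, contDiff_succ_iff_deriv] at hz
      exact hz.2.2
    exact ⟨fun t => (hz.differentiable (by norm_num) t).hasDerivAt,
      fun t => (hd.differentiable (by norm_num) t).hasDerivAt⟩
  have hδ0 : zp 0 - zp' 0 = h - h' := by rw [hz3, hz3']; abel
  intro t ht
  refine ⟨?_, fun η hη0 hη1 => hlow t ht η (1 - η) hη0.le (by linarith) (by ring)⟩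
  rw [← hδ0]
  refine norm_le_two_mul_of_norm_deriv2_le (δ := fun s => zp s - zp' s) (c := 2 * C) (β := βl2)
    ha hk0 hα0 hβl2.le (by positivity) ?_
    (fun s => ((hder zp hz1).1 s).sub ((hder zp' hz1').1 s))
    (fun s => ((hder zp hz1).2 s).sub ((hder zp' hz1').2 s))
    (by simpa using hz4.sub hz4') ?_ ?_ ht
  · have h1 : 2 ^ 5 * 1 * βl2 ≤ 2 ^ 5 * (n : ℝ) * max βl1 βl2 := by
      gcongr; exact le_max_right _ _
    rw [hksq]
    linarith
  · intro s hs
    have hpos : 0 < a + k * s := by positivity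
    rw [hz2, hz2', hFl, hFl, neg_sub_neg, ← norm_sub_rev]
    refine norm_gradient_sub_le hVl.1 fun u hu => ?_
    obtain ⟨η, ζ, hη, hζ, hηζ, rfl⟩ := hu
    refine (hVl.2.2.2 _).trans ?_
    have h1 := hlow s hs η ζ hη hζ hηζ
    have h2 : s * ‖v‖ / (2 * √2) = k * s := by rw [hk]; ring
    refine mul_le_mul_of_nonneg_left
      (Real.rpow_le_rpow_of_nonpos hpos (by linarith) (by linarith)) hβl2.le
  · intro s hs
    have e : zp s - zp' s = (zp 0 - zp' 0) + ((zp s - (x + h) - s • w)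
        - (zp' s - (x + h') - s • w)) := by
      rw [hδ0]; abel
    have h1 := norm_sub_le (zp s - (x + h) - s • w) (zp' s - (x + h') - s • w)
    have h2 := norm_add_le (zp 0 - zp' 0) ((zp s - (x + h) - s • w)
        - (zp' s - (x + h') - s • w))
    rw [← e] at h2
    linarith [hg s hs, hg' s hs]

end Paper
end
end

section
/- Let θ ∈ ℝⁿ with |θ| = 1 and x ∈ ℝⁿ with θ·x = 0, let r ∈ (0, 1/2 + |x|/2^{3/2}), and let s ≥ μ(|x|) satisfy s > 2^{3/2} r, 20 n max(β^l_1, β₂) ≤ α(s/(2√2) − r)²(1/2 + |x|/(2√2) − r)^α, and 12βn(1 + 1/(2^{−3/2}s − r))² ≤ α r (2^{−3/2}s − r)(1/2 − r + |x|/2^{3/2})^α. Then 𝒜 (with v_− = sθ, x_− = x) has a unique fixed point y_− in M_r, and with ã_sc, b̃_sc, W̃ as defined below: |ã_sc(sθ,x) − W̃(sθ,x) − ∫_{−∞}^∞ F^s(τ sθ + x) dτ| ≤ 12 n² β² (3 + 2/(2^{−3/2}s − r))² / (α(α+1)(2^{−3/2}s − r)²(1 − r + |x|/√2)^{2α+1}),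 and |b̃_sc(sθ,x) − ∫_{−∞}^0 ∫_{−∞}^σ F^s(τ sθ + x) dτ dσ + ∫_0^∞ ∫_σ^∞ F^s(τ sθ + x) dτ dσ| ≤ 24 n² β² (3 + 1/(2^{−3/2}s − r))² / (α²(α+1)(2^{−3/2}s − r)³(1 − r + |x|/√2)^{2α}). -/
open MeasureTheory Real Filter Set Topology RealInnerProductSpace

noncomputable section

namespace Paper

variable {n : ℕ}

section HalfLine

variable {E : Type*} [NormedAddCommGroup E] [NormedSpace ℝ E]

lemma hasDerivAt_weight {D V p τ : ℝ} (h : 0 < D + V * τ) :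
    HasDerivAt (fun τ => (D + V * τ) ^ (-p)) (-(p * V) * (D + V * τ) ^ (-(p + 1))) τ := by
  have h1 : HasDerivAt (fun τ : ℝ => D + V * τ) V τ := by
    simpa using ((hasDerivAt_id τ).const_mul V).const_add D
  have h2 := h1.rpow_const (p := -p) (Or.inl h.ne')
  convert h2 using 1
  rw [show -(p + 1) = -p - 1 by ring]
  ring

lemma integral_weight {D V p : ℝ} (hD : 0 < D) (hV : 0 < V) (hp : 0 < p) {t : ℝ} (ht : 0 ≤ t) :
    IntegrableOn (fun τ => (D + V * τ) ^ (-(p + 1))) (Ioi t) ∧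
      ∫ τ in Ioi t, (D + V * τ) ^ (-(p + 1)) = (D + V * t) ^ (-p) / (p * V) := by
  have hpos : ∀ τ, t ≤ τ → 0 < D + V * τ := fun τ h => by
    have := mul_nonneg hV.le (ht.trans h); linarith
  have hd : ∀ τ ∈ Ici t, HasDerivAt (fun τ => -(D + V * τ) ^ (-p) / (p * V))
      ((D + V * τ) ^ (-(p + 1))) τ := fun τ h => by
    exact ((hasDerivAt_weight (p := p) (hpos τ h)).neg.div_const (p * V)).congr_deriv
      (by field_simp)
  have hlim : Tendsto (fun τ => -(D + V * τ) ^ (-p) / (p * V)) atTop (𝓝 0) := by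
    have h1 : Tendsto (fun τ : ℝ => D + V * τ) atTop atTop :=
      tendsto_atTop_add_const_left _ _ (tendsto_id.const_mul_atTop hV)
    have h2 := ((tendsto_rpow_neg_atTop hp).comp h1).neg.div_const (p * V)
    simpa using h2
  have hnn : ∀ τ ∈ Ioi t, 0 ≤ (D + V * τ) ^ (-(p + 1)) :=
    fun τ h => rpow_nonneg (hpos τ (le_of_lt h)).le _
  refine ⟨integrableOn_Ioi_deriv_of_nonneg' hd hnn hlim, ?_⟩
  rw [integral_Ioi_of_hasDerivAt_of_nonneg' hd hnn hlim]
  ring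

lemma tail_bound {D V p a : ℝ} (hD : 0 < D) (hV : 0 < V) (hp : 0 < p) {g : ℝ → E}
    (hg : Continuous g) (h : ∀ τ, 0 ≤ τ → ‖g τ‖ ≤ a * (D + V * τ) ^ (-(p + 1))) :
    (∀ t, IntegrableOn g (Ici t)) ∧
      ∀ t, 0 ≤ t → ‖∫ τ in Ici t, g τ‖ ≤ a / (p * V) * (D + V * t) ^ (-p) := by
  have key : ∀ t, 0 ≤ t → IntegrableOn g (Ici t) := fun t ht => by
    rw [integrableOn_Ici_iff_integrableOn_Ioi]
    refine Integrable.mono' ((integral_weight hD hV hp ht).1.const_mul a)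
      hg.aestronglyMeasurable ?_
    filter_upwards [ae_restrict_mem measurableSet_Ioi] with τ hτ
    exact h τ (ht.trans (le_of_lt hτ))
  refine ⟨fun t => ?_, fun t ht => ?_⟩
  · have h1 : IntegrableOn g (Icc t 0) := hg.continuousOn.integrableOn_compact isCompact_Icc
    refine (h1.union (key 0 le_rfl)).mono_set fun τ hτ => ?_
    rcases le_total τ 0 with h0 | h0
    · exact Or.inl ⟨hτ, h0⟩
    · exact Or.inr h0
  · obtain ⟨h1, h2⟩ := integral_weight hD hV hp ht
    rw [integral_Ici_eq_integral_Ioi]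
    refine (norm_integral_le_of_norm_le (h1.const_mul a) ?_).trans ?_
    · filter_upwards [ae_restrict_mem measurableSet_Ioi] with τ hτ
      exact h τ (ht.trans (le_of_lt hτ))
    · rw [integral_const_mul, h2]
      apply le_of_eq; ring

lemma hasDerivAt_integral_Iic [CompleteSpace E] {g : ℝ → E} (hg : Continuous g)
    (hi : ∀ t, IntegrableOn g (Iic t)) (t : ℝ) :
    HasDerivAt (fun t => ∫ τ in Iic t, g τ) (g t) t := by
  have h1 : (fun t => ∫ τ in Iic t, g τ) = fun t => (∫ τ in (0:ℝ)..t, g τ) + ∫ τ in Iic 0, g τ := by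
    funext u
    rw [← intervalIntegral.integral_Iic_sub_Iic (hi 0) (hi u)]; abel
  rw [h1]
  exact (hg.integral_hasStrictDerivAt 0 t).hasDerivAt.add_const _

lemma integral_Iic_eq_Ici_neg (g : ℝ → E) (t : ℝ) :
    ∫ τ in Iic t, g τ = ∫ τ in Ici (-t), g (-τ) := by
  rw [integral_Ici_eq_integral_Ioi, ← integral_comp_neg_Iic t (fun τ => g (-τ))]
  simp

lemma hasDerivAt_integral_Ici [CompleteSpace E] {g : ℝ → E} (hg : Continuous g)
    (hi : ∀ t, IntegrableOn g (Ici t)) (t : ℝ) :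
    HasDerivAt (fun t => ∫ τ in Ici t, g τ) (-g t) t := by
  have h1 : (fun t => ∫ τ in Ici t, g τ) = fun t => (∫ τ in Ici 0, g τ) - ∫ τ in (0:ℝ)..t, g τ := by
    funext u
    have h2 := intervalIntegral.integral_Ioi_sub_Ioi' ((hi 0).mono_set Ioi_subset_Ici_self)
      ((hi u).mono_set Ioi_subset_Ici_self)
    rw [← h2, integral_Ici_eq_integral_Ioi, integral_Ici_eq_integral_Ioi]; abel
  rw [h1]
  exact (hg.integral_hasStrictDerivAt 0 t).hasDerivAt.const_sub _

/-- Iterated tail integrals of a function decaying like `w ^ (-(α + 2))`, `w τ = D + V τ`. -/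
lemma iterated_tail_bound [CompleteSpace E] {D V α a : ℝ} (hD : 0 < D) (hV : 0 < V) (hα : 0 < α)
    {g : ℝ → E} (hg : Continuous g)
    (h : ∀ τ, 0 ≤ τ → ‖g τ‖ ≤ a * (D + V * τ) ^ (-(α + 2))) :
    (∀ t, IntegrableOn g (Ici t)) ∧
    (∀ t, 0 ≤ t → ‖∫ τ in Ici t, g τ‖ ≤ a / ((α + 1) * V) * (D + V * t) ^ (-(α + 1))) ∧
    (∀ t, IntegrableOn (fun σ => ∫ τ in Ici σ, g τ) (Ici t)) ∧
    ∀ t, 0 ≤ t → ‖∫ σ in Ici t, ∫ τ in Ici σ, g τ‖ ≤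
      a * (D ^ (-α) / (α * (α + 1) * V ^ 2)) := by
  have h' : ∀ τ, 0 ≤ τ → ‖g τ‖ ≤ a * (D + V * τ) ^ (-((α + 1) + 1)) := by
    intro τ hτ; convert h τ hτ using 3; ring
  obtain ⟨i1, b1⟩ := tail_bound hD hV (by linarith : 0 < α + 1) hg h'
  have hc : Continuous fun σ => ∫ τ in Ici σ, g τ :=
    continuous_iff_continuousAt.2 fun t => (hasDerivAt_integral_Ici hg i1 t).continuousAt
  obtain ⟨i2, b2⟩ := tail_bound hD hV hα hc b1
  refine ⟨i1, b1, i2, fun t ht => (b2 t ht).trans ?_⟩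
  have ha : 0 ≤ a := by
    have := (norm_nonneg _).trans (h 0 le_rfl)
    exact nonneg_of_mul_nonneg_left this (rpow_pos_of_pos (by linarith) _)
  have hw : (D + V * t) ^ (-α) ≤ D ^ (-α) :=
    rpow_le_rpow_of_nonpos hD (by nlinarith [mul_nonneg hV.le ht]) (by linarith)
  calc _ ≤ a / ((α + 1) * V) / (α * V) * D ^ (-α) := by gcongr
    _ = _ := by field_simp

end HalfLine

/-- The iterated integral of `(D + V τ) ^ (-(α + 2))` over a half-line. -/
def doubleC (α D V : ℝ) : ℝ := D ^ (-α) / (α * (α + 1) * V ^ 2)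

/-- The integral of `(D + V τ) ^ (-(α + 2))` over a half-line. -/
def singleC (α D V : ℝ) : ℝ := D ^ (-(α + 1)) / ((α + 1) * V)

/-- An upper bound for the integral of `τ (D + V τ) ^ (-(α + 2))` over a half-line. -/
def linearC (α D V : ℝ) : ℝ := D ^ (-α) / (α * V ^ 2)

section Iterated

variable {E : Type*} [NormedAddCommGroup E] [NormedSpace ℝ E] {D V α a b : ℝ}

lemma doubleC_pos (hD : 0 < D) (hV : 0 < V) (hα : 0 < α) : 0 < doubleC α D V := by
  unfold doubleC; positivity

lemma singleC_pos (hD : 0 < D) (hV : 0 < V) (hα : 0 < α) : 0 < singleC α D V := by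
  unfold singleC; positivity

lemma linearC_pos (hD : 0 < D) (hV : 0 < V) (hα : 0 < α) : 0 < linearC α D V := by
  unfold linearC; positivity

lemma iterated_Ici [CompleteSpace E] (hD : 0 < D) (hV : 0 < V) (hα : 0 < α)
    {g : ℝ → E} (hg : Continuous g)
    (h : ∀ τ, 0 ≤ τ → ‖g τ‖ ≤ a * (D + V * |τ|) ^ (-(α + 2))) :
    (∀ t, IntegrableOn g (Ici t)) ∧ ‖∫ τ in Ici 0, g τ‖ ≤ a * singleC α D V ∧
    IntegrableOn (fun σ => ∫ τ in Ici σ, g τ) (Ici 0) ∧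
    ‖∫ σ in Ici 0, ∫ τ in Ici σ, g τ‖ ≤ a * doubleC α D V := by
  obtain ⟨h1, h2, h3, h4⟩ := iterated_tail_bound hD hV hα hg
    (fun τ hτ => by simpa [abs_of_nonneg hτ] using h τ hτ)
  refine ⟨h1, (h2 0 le_rfl).trans_eq ?_, h3 0, h4 0 le_rfl⟩
  unfold singleC
  simp only [mul_zero, add_zero]; ring

lemma iterated_Iic [CompleteSpace E] (hD : 0 < D) (hV : 0 < V) (hα : 0 < α)
    {g : ℝ → E} (hg : Continuous g)
    (h : ∀ τ, τ ≤ 0 → ‖g τ‖ ≤ a * (D + V * |τ|) ^ (-(α + 2))) :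
    (∀ t, IntegrableOn g (Iic t)) ∧ ‖∫ τ in Iic 0, g τ‖ ≤ a * singleC α D V ∧
    (∀ t, IntegrableOn (fun σ => ∫ τ in Iic σ, g τ) (Iic t)) ∧
    ∀ t, t ≤ 0 → ‖∫ σ in Iic t, ∫ τ in Iic σ, g τ‖ ≤ a * doubleC α D V := by
  obtain ⟨h1, h2, h3, h4⟩ := iterated_tail_bound (g := fun τ => g (-τ)) hD hV hα
    (hg.comp continuous_neg) (fun τ hτ => by
      simpa [abs_of_nonneg hτ] using h (-τ) (by linarith))
  have refl : ∀ (f : ℝ → E) t, IntegrableOn (fun τ => f (-τ)) (Ici (-t)) →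
      IntegrableOn f (Iic t) := by
    intro f t hf
    have := (integrableOn_Ici_iff_integrableOn_Ioi (f := fun τ => f (-τ))).1 hf
    rw [← integrableOn_Ici_iff_integrableOn_Ioi] at this
    simpa using this.comp_neg_Iic
  refine ⟨fun t => refl g t (h1 _), ?_, fun t => refl _ t ?_, fun t ht => ?_⟩
  · rw [integral_Iic_eq_Ici_neg, neg_zero]
    refine (h2 0 le_rfl).trans_eq ?_
    unfold singleC
    simp only [mul_zero, add_zero]; ring
  · simpa only [integral_Iic_eq_Ici_neg, neg_neg] using h3 (-t)
  · simpa only [integral_Iic_eq_Ici_neg, neg_neg, doubleC] using h4 (-t) (by linarith)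

lemma tail_bound_linear (hD : 0 < D) (hV : 0 < V) (hα : 0 < α) (hb : 0 ≤ b)
    {g : ℝ → E} (hg : Continuous g)
    (h : ∀ τ, 0 ≤ τ → ‖g τ‖ ≤ (a + b * τ) * (D + V * |τ|) ^ (-(α + 2))) :
    (∀ t, IntegrableOn g (Ici t)) ∧ ∀ t, 0 ≤ t → ∀ s ⊆ Ioi t, MeasurableSet s →
      ‖∫ τ in s, g τ‖ ≤ a * ((D + V * t) ^ (-(α + 1)) / ((α + 1) * V)) + b * linearC α D V := by
  have ha : 0 ≤ a := by
    have := (norm_nonneg _).trans (h 0 le_rfl)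
    rw [mul_zero, add_zero] at this
    exact nonneg_of_mul_nonneg_left this (by simp only [abs_zero, mul_zero, add_zero]; positivity)
  have hpos : ∀ τ, 0 ≤ τ → 0 < D + V * τ := fun τ h => by
    have := mul_nonneg hV.le h; linarith
  have hmaj : ∀ τ, 0 ≤ τ → ‖g τ‖ ≤
      a * (D + V * τ) ^ (-((α + 1) + 1)) + b / V * (D + V * τ) ^ (-(α + 1)) := by
    intro τ hτ
    have hw := hpos τ hτ
    have e1 : (D + V * τ) ^ (-(α + 1)) = (D + V * τ) ^ (-(α + 2)) * (D + V * τ) := by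
      rw [← rpow_add_one hw.ne']; ring_nf
    have e2 : -((α + 1) + 1) = -(α + 2) := by ring
    rw [e1, e2]
    have h0 := h τ hτ
    rw [abs_of_nonneg hτ] at h0
    have h3 : τ ≤ (D + V * τ) / V := by rw [le_div_iff₀ hV]; linarith
    calc _ ≤ _ := h0
      _ ≤ (a + b * ((D + V * τ) / V)) * (D + V * τ) ^ (-(α + 2)) := by gcongr
      _ = _ := by field_simp
  have hmi : ∀ t, 0 ≤ t → IntegrableOn (fun τ => a * (D + V * τ) ^ (-((α + 1) + 1)) +
      b / V * (D + V * τ) ^ (-(α + 1))) (Ioi t) := fun t ht =>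
    ((integral_weight hD hV (by linarith) ht).1.const_mul a).add
      ((integral_weight hD hV hα ht).1.const_mul (b / V))
  refine ⟨fun t => ?_, fun t ht s hs hsm => ?_⟩
  · have key : IntegrableOn g (Ici 0) := by
      rw [integrableOn_Ici_iff_integrableOn_Ioi]
      refine Integrable.mono' (hmi 0 le_rfl) hg.aestronglyMeasurable ?_
      filter_upwards [ae_restrict_mem measurableSet_Ioi] with τ hτ
      exact hmaj τ (le_of_lt hτ)
    have h1 : IntegrableOn g (Icc t 0) := hg.continuousOn.integrableOn_compact isCompact_Icc
    refine (h1.union key).mono_set fun τ hτ => ?_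
    rcases le_total τ 0 with h0 | h0
    · exact Or.inl ⟨hτ, h0⟩
    · exact Or.inr h0
  · have h1 : ‖∫ τ in s, g τ‖ ≤ ∫ τ in s, (a * (D + V * τ) ^ (-((α + 1) + 1)) +
      b / V * (D + V * τ) ^ (-(α + 1))) := by
      refine norm_integral_le_of_norm_le ((hmi t ht).mono_set hs) ?_
      filter_upwards [ae_restrict_mem hsm] with τ hτ
      exact hmaj τ (ht.trans (le_of_lt (hs hτ)))
    refine h1.trans ((setIntegral_mono_set (hmi t ht) ?_ (LE.le.eventuallyLE hs)).trans ?_)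
    · filter_upwards [ae_restrict_mem measurableSet_Ioi] with τ hτ
      have := hpos τ (ht.trans (le_of_lt hτ))
      simp only [Pi.zero_apply]
      positivity
    · rw [integral_add ((integral_weight hD hV (by linarith) ht).1.const_mul a)
        ((integral_weight hD hV hα ht).1.const_mul (b / V)), integral_const_mul,
        integral_const_mul, (integral_weight hD hV (by linarith : 0 < α + 1) ht).2,
        (integral_weight hD hV hα ht).2]
      have hw : (D + V * t) ^ (-α) ≤ D ^ (-α) :=
        rpow_le_rpow_of_nonpos hD (by nlinarith [mul_nonneg hV.le ht]) (by linarith)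
      unfold linearC
      calc _ ≤ a * ((D + V * t) ^ (-(α + 1)) / ((α + 1) * V)) + b / V * (D ^ (-α) / (α * V)) := by
            gcongr
        _ = _ := by field_simp

lemma iterated_past [CompleteSpace E] {a' : ℝ} (hD : 0 < D) (hV : 0 < V) (hα : 0 < α) (hb : 0 ≤ b)
    {g : ℝ → E} (hg : Continuous g)
    (h : ∀ τ, τ ≤ 0 → ‖g τ‖ ≤ a * (D + V * |τ|) ^ (-(α + 2)))
    (h' : ∀ τ, 0 ≤ τ → ‖g τ‖ ≤ (a' + b * τ) * (D + V * |τ|) ^ (-(α + 2))) :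
    (∀ t, HasDerivAt (fun t => ∫ σ in Iic t, ∫ τ in Iic σ, g τ) (∫ τ in Iic t, g τ) t) ∧
    (∀ t, t ≤ 0 → ‖∫ σ in Iic t, ∫ τ in Iic σ, g τ‖ ≤ a * doubleC α D V) ∧
    ∀ t, 0 ≤ t → ‖∫ σ in Iic t, ∫ τ in Iic σ, g τ‖ ≤
      a * doubleC α D V + ((a + a') * singleC α D V + b * linearC α D V) * t := by
  obtain ⟨i1, b1, i2, b2⟩ := iterated_Iic hD hV hα hg h
  obtain ⟨-, b3⟩ := tail_bound_linear hD hV hα hb hg h'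
  have hc : Continuous fun σ => ∫ τ in Iic σ, g τ :=
    continuous_iff_continuousAt.2 fun t => (hasDerivAt_integral_Iic hg i1 t).continuousAt
  have hd := hasDerivAt_integral_Iic hc i2
  refine ⟨hd, b2, fun t ht => ?_⟩
  have hbd : ∀ u ∈ Ici (0:ℝ), ‖∫ τ in Iic u, g τ‖ ≤
      (a + a') * singleC α D V + b * linearC α D V := by
    intro u hu
    have e : ∫ τ in Iic u, g τ = (∫ τ in Iic 0, g τ) + ∫ τ in Ioc 0 u, g τ := by
      rw [← intervalIntegral.integral_of_le hu, ← intervalIntegral.integral_Iic_sub_Iic (i1 0) (i1 u)]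
      abel
    rw [e]
    have h3 := b3 0 le_rfl (Ioc 0 u) Ioc_subset_Ioi_self measurableSet_Ioc
    rw [mul_zero, add_zero] at h3
    refine (norm_add_le _ _).trans ((add_le_add b1 h3).trans_eq ?_)
    unfold singleC; ring
  have h4 := (convex_Ici (0:ℝ)).norm_image_sub_le_of_norm_hasDerivWithin_le
    (fun u _ => (hd u).hasDerivWithinAt) hbd (mem_Ici.2 le_rfl) (mem_Ici.2 ht)
  rw [sub_zero, norm_of_nonneg ht] at h4
  calc _ ≤ ‖∫ σ in Iic 0, ∫ τ in Iic σ, g τ‖ + _ := norm_le_norm_add_norm_sub' _ _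
    _ ≤ _ := add_le_add (b2 0 le_rfl) h4

lemma future_difference_bound [CompleteSpace E] (hD : 0 < D) (hV : 0 < V) (hα : 0 < α) (hb : 0 ≤ b)
    {g : ℝ → E} (hg : Continuous g)
    (h : ∀ τ, 0 ≤ τ → ‖g τ‖ ≤ (a + b * τ) * (D + V * |τ|) ^ (-(α + 2)))
    {d : ℝ → E} (hd : ∀ t, 0 ≤ t → HasDerivAt d (-∫ τ in Ici t, g τ) t) {t : ℝ} (ht : 0 ≤ t) :
    ‖d t‖ ≤ ‖d 0‖ + a * doubleC α D V + b * linearC α D V * t := by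
  have ha : 0 ≤ a := by
    have := (norm_nonneg _).trans (h 0 le_rfl)
    rw [mul_zero, add_zero] at this
    exact nonneg_of_mul_nonneg_left this (by simp only [abs_zero, mul_zero, add_zero]; positivity)
  obtain ⟨-, b3⟩ := tail_bound_linear hD hV hα hb hg h
  have hpos : ∀ τ, 0 ≤ τ → 0 < D + V * τ := fun τ h => by
    have := mul_nonneg hV.le h; linarith
  let c := a / (α * (α + 1) * V ^ 2)
  let K := b * linearC α D V
  let B' : ℝ → ℝ := fun u => a * ((D + V * u) ^ (-(α + 1)) / ((α + 1) * V)) + K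
  let B : ℝ → ℝ := fun u => (‖d 0‖ + c * (D ^ (-α) - (D + V * u) ^ (-α))) + K * u
  have hB : ∀ u ∈ Ico 0 t, HasDerivAt B (B' u) u := by
    intro u hu
    have h1 := (((hasDerivAt_weight (p := α) (hpos u hu.1)).const_sub (D ^ (-α))).const_mul
      c).const_add ‖d 0‖
    have h2 := h1.add ((hasDerivAt_id u).const_mul K)
    refine h2.congr_deriv ?_
    simp only [B', c]
    field_simp
  have hcont : ContinuousOn B (Icc 0 t) := by
    intro u hu
    have h1 := (((hasDerivAt_weight (p := α) (hpos u hu.1)).const_sub (D ^ (-α))).const_mul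
      c).const_add ‖d 0‖
    have h2 := h1.add ((hasDerivAt_id u).const_mul K)
    exact h2.continuousAt.continuousWithinAt
  have key := image_norm_le_of_norm_deriv_right_le_deriv_boundary' (f := d) (a := 0) (b := t)
    (f' := fun u => -∫ τ in Ici u, g τ) (B := B) (B' := B')
    (fun u hu => (hd u hu.1).continuousAt.continuousWithinAt)
    (fun u hu => (hd u hu.1).hasDerivWithinAt) (by simp [B]) hcont
    (fun u hu => (hB u hu).hasDerivWithinAt) (fun u hu => by
      rw [norm_neg, integral_Ici_eq_integral_Ioi]
      exact b3 u hu.1 _ subset_rfl measurableSet_Ioi) (right_mem_Icc.2 ht)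
  refine key.trans ?_
  have hw : 0 ≤ (D + V * t) ^ (-α) := (rpow_pos_of_pos (hpos t ht) _).le
  have hc0 : 0 ≤ c := by simp only [c]; positivity
  have e : a * doubleC α D V = c * D ^ (-α) := by simp only [c, doubleC]; ring
  simp only [B]
  rw [e]
  have := mul_nonneg hc0 hw
  simp only [K]
  linarith

end Iterated

section Space

lemma memM_iff {r : ℝ} {f : ℝ → Euc n} :
    MemM r f ↔ Continuous f ∧ ∀ t ≤ 0, ∀ u, 0 ≤ u → ‖f t‖ + ‖f u‖ / (1 + u) ≤ r := by
  constructor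
  · rintro ⟨hc, hb1, hb2, hn⟩
    refine ⟨hc, fun t ht u hu => le_trans (add_le_add ?_ ?_) hn⟩
    · exact le_csSup hb1 ⟨t, ht, rfl⟩
    · exact le_csSup hb2 ⟨u, hu, rfl⟩
  · rintro ⟨hc, h⟩
    have hn1 : ((fun t => ‖f t‖) '' Iic 0).Nonempty := ⟨_, 0, mem_Iic.2 le_rfl, rfl⟩
    have hn2 : ((fun t => ‖f t‖ / (1 + t)) '' Ici 0).Nonempty := ⟨_, 0, mem_Ici.2 le_rfl, rfl⟩
    refine ⟨hc, ⟨r, ?_⟩, ⟨r, ?_⟩, ?_⟩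
    · rintro _ ⟨t, ht, rfl⟩
      have := h t ht 0 le_rfl
      have h2 : 0 ≤ ‖f 0‖ / (1 + 0) := by positivity
      simp only; linarith
    · rintro _ ⟨t, ht, rfl⟩
      have := h 0 le_rfl t ht
      have h2 := norm_nonneg (f 0)
      simp only; linarith
    · unfold Mnorm
      rw [← le_sub_iff_add_le]
      refine csSup_le hn1 ?_
      rintro _ ⟨t, ht, rfl⟩
      rw [le_sub_comm]
      refine csSup_le hn2 ?_
      rintro _ ⟨u, hu, rfl⟩
      have := h t ht u hu
      simp only; linarith

lemma MemM.norm_le_of_nonpos {r : ℝ} {f : ℝ → Euc n} (h : MemM r f) {t : ℝ} (ht : t ≤ 0) :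
    ‖f t‖ ≤ r := by
  have := (memM_iff.1 h).2 t ht 0 le_rfl
  have h2 : 0 ≤ ‖f 0‖ / (1 + 0) := by positivity
  linarith

lemma MemM.norm_le_of_nonneg {r : ℝ} {f : ℝ → Euc n} (h : MemM r f) {t : ℝ} (ht : 0 ≤ t) :
    ‖f t‖ ≤ r * (1 + t) := by
  have := (memM_iff.1 h).2 0 le_rfl t ht
  have h2 := norm_nonneg (f 0)
  rw [← div_le_iff₀ (by linarith)]
  linarith

lemma MemM.norm_le {r : ℝ} {f : ℝ → Euc n} (h : MemM r f) (t : ℝ) :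
    ‖f t‖ ≤ r * |t| + r := by
  rcases le_total t 0 with ht | ht
  · have h1 := h.norm_le_of_nonpos ht
    have h2 := mul_nonneg ((norm_nonneg _).trans h1) (abs_nonneg t)
    linarith
  · have h1 := h.norm_le_of_nonneg ht
    rw [abs_of_nonneg ht]; linarith

/-- Banach's fixed point theorem on the space of `MemM`. -/
lemma existsUnique_fixedPoint_of_contraction {r : ℝ} (hr : 0 ≤ r)
    (A : (ℝ → Euc n) → ℝ → Euc n) (hmaps : ∀ f, MemM r f → MemM r (A f))
    (hc : ∀ f₁ f₂, MemM r f₁ → MemM r f₂ → ∀ ρ, 0 ≤ ρ →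
      (∀ t, ‖f₁ t - f₂ t‖ ≤ ρ * (1 + max t 0)) →
      ∀ t, ‖A f₁ t - A f₂ t‖ ≤ ρ / 2 * (1 + max t 0)) :
    ∃! y, MemM r y ∧ A y = y := by
  have hw : ∀ t : ℝ, 0 < 1 + max t 0 := fun t => by
    have := le_max_right t 0; linarith
  have hwc : Continuous fun t : ℝ => 1 + max t 0 := by fun_prop
  let K : Set (BoundedContinuousFunction ℝ (Euc n)) :=
    {g | ∀ t ≤ 0, ∀ u, 0 ≤ u → ‖g t‖ + ‖g u‖ ≤ r}
  have hK : IsClosed K := by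
    have : K = ⋂ t ∈ Iic (0:ℝ), ⋂ u ∈ Ici (0:ℝ), {g | ‖g t‖ + ‖g u‖ ≤ r} := by
      ext g; simp [K]
    rw [this]
    refine isClosed_biInter fun t _ => isClosed_biInter fun u _ => ?_
    have e1 : ∀ t : ℝ, Continuous fun g : BoundedContinuousFunction ℝ (Euc n) => g t :=
      fun t => continuous_eval_const t
    exact isClosed_le ((e1 t).norm.add (e1 u).norm) continuous_const
  let up : BoundedContinuousFunction ℝ (Euc n) → ℝ → Euc n := fun g t => (1 + max t 0) • g t
  have hup : ∀ g ∈ K, MemM r (up g) := by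
    intro g hg
    refine memM_iff.2 ⟨hwc.smul g.continuous, fun t ht u hu => ?_⟩
    have := hg t ht u hu
    have hu' : (0:ℝ) < 1 + u := by linarith
    simp only [up, norm_smul, max_eq_right ht, max_eq_left hu, add_zero, norm_one, one_mul,
      norm_of_nonneg hu'.le]
    rwa [mul_div_cancel_left₀ _ hu'.ne']
  have hdown : ∀ f, MemM r f → ∃ g ∈ K, up g = f := by
    intro f hf
    have hcf := hf.1
    refine ⟨BoundedContinuousFunction.ofNormedAddCommGroup (fun t => (1 + max t 0)⁻¹ • f t)
      ((hwc.inv₀ fun t => (hw t).ne').smul hcf) r ?_, ?_, ?_⟩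
    · intro t
      rw [norm_smul, norm_inv, norm_of_nonneg (hw t).le, inv_mul_le_iff₀ (hw t)]
      rcases le_total t 0 with ht | ht
      · simpa [max_eq_right ht] using hf.norm_le_of_nonpos ht
      · rw [max_eq_left ht, mul_comm]; exact hf.norm_le_of_nonneg ht
    · intro t ht u hu
      have := (memM_iff.1 hf).2 t ht u hu
      have hu' : (0:ℝ) < 1 + u := by linarith
      simp only [BoundedContinuousFunction.coe_ofNormedAddCommGroup, norm_smul, norm_inv,
        max_eq_right ht, max_eq_left hu, norm_of_nonneg hu'.le, add_zero, norm_one, inv_one,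
        one_mul]
      rwa [inv_mul_eq_div]
    · funext t
      simp only [up, BoundedContinuousFunction.coe_ofNormedAddCommGroup]
      rw [smul_inv_smul₀ (hw t).ne']
  choose! down hdK hdU using hdown
  let T : K → K := fun g => ⟨down (A (up g)), hdK _ (hmaps _ (hup g g.2))⟩
  have hT : ∀ g : K, up (T g) = A (up g) := fun g => hdU _ (hmaps _ (hup g g.2))
  have hcontr : ContractingWith (1 / 2) T := by
    refine ⟨by norm_num, LipschitzWith.of_dist_le_mul fun g₁ g₂ => ?_⟩
    rw [Subtype.dist_eq, Subtype.dist_eq]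
    have hρ : (0:ℝ) ≤ dist (g₁ : BoundedContinuousFunction ℝ (Euc n)) g₂ := dist_nonneg
    refine (BoundedContinuousFunction.dist_le (mul_nonneg (NNReal.coe_nonneg _) hρ)).2 fun t => ?_
    have h1 := hc _ _ (hup g₁ g₁.2) (hup g₂ g₂.2) _ hρ (fun t => by
      simp only [up]
      rw [← smul_sub, norm_smul, norm_of_nonneg (hw t).le, mul_comm, ← dist_eq_norm]
      exact mul_le_mul_of_nonneg_right (BoundedContinuousFunction.dist_coe_le_dist t)
        (hw t).le) t
    rw [← hT, ← hT] at h1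
    simp only [up] at h1
    rw [← smul_sub, norm_smul, norm_of_nonneg (hw t).le, mul_comm] at h1
    rw [dist_eq_norm]
    have h2 := le_of_mul_le_mul_right h1 (hw t)
    simpa [div_eq_inv_mul] using h2
  have : CompleteSpace K := hK.completeSpace_coe
  have : Nonempty K := ⟨⟨0, fun t _ u _ => by simpa using hr⟩⟩
  have hfix := hcontr.fixedPoint_isFixedPt
  refine ⟨up (ContractingWith.fixedPoint T hcontr : K), ⟨hup _ (Subtype.prop _), ?_⟩, ?_⟩
  · rw [← hT, hfix]
  · rintro y ⟨hy, hAy⟩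
    let g : K := ⟨down y, hdK y hy⟩
    have hg : Function.IsFixedPt T g := by
      apply Subtype.ext
      simp only [T, g]
      rw [hdU y hy, hAy]
    rw [← hcontr.fixedPoint_unique hg]
    exact (hdU y hy).symm

lemma bootstrap {s : Set ℝ} {φ q : ℝ → ℝ} {A A' ε B₀ g₀ : ℝ} (hA : 0 ≤ A) (hA' : 0 ≤ A')
    (hε0 : 0 ≤ ε) (hε1 : ε < 1) (hB₀ : 0 ≤ B₀) (hg₀ : 0 ≤ g₀)
    (h0 : ∀ t ∈ s, φ t ≤ B₀ + g₀ * q t)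
    (step : ∀ B g, 0 ≤ B → 0 ≤ g → (∀ t ∈ s, φ t ≤ B + g * q t) →
      ∀ t ∈ s, φ t ≤ (A + ε * B) + (A' + ε * g) * q t) :
    ∀ t ∈ s, φ t ≤ A / (1 - ε) + A' / (1 - ε) * q t := by
  let S : ℝ → ℝ → ℕ → ℝ := fun A B k => (fun x => A + ε * x)^[k] B
  have hSnn : ∀ A B, 0 ≤ A → 0 ≤ B → ∀ k, 0 ≤ S A B k := by
    intro A B hA hB k
    induction k with
    | zero => exact hB
    | succ k ih =>
      simp only [S, Function.iterate_succ_apply'] at ih ⊢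
      positivity
  have hSf : ∀ A B k, S A B k = A / (1 - ε) + ε ^ k * (B - A / (1 - ε)) := by
    intro A B k
    have : 1 - ε ≠ 0 := by linarith
    induction k with
    | zero => simp [S]
    | succ k ih =>
      simp only [S, Function.iterate_succ_apply'] at ih ⊢
      rw [ih, pow_succ]
      field_simp
      ring
  have hlim : ∀ A B, Tendsto (S A B) atTop (𝓝 (A / (1 - ε))) := by
    intro A B
    have := ((tendsto_pow_atTop_nhds_zero_of_lt_one hε0 hε1).mul_const
      (B - A / (1 - ε))).const_add (A / (1 - ε))
    simp only [zero_mul, add_zero] at this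
    exact this.congr fun k => (hSf A B k).symm
  have hall : ∀ k, ∀ t ∈ s, φ t ≤ S A B₀ k + S A' g₀ k * q t := by
    intro k
    induction k with
    | zero => exact h0
    | succ k ih =>
      have := step _ _ (hSnn A B₀ hA hB₀ k) (hSnn A' g₀ hA' hg₀ k) ih
      simpa only [S, Function.iterate_succ_apply'] using this
  intro t ht
  exact ge_of_tendsto' ((hlim A B₀).add ((hlim A' g₀).mul_const (q t))) fun k => hall k t ht

end Space

section Force

lemma continuous_gradient {U : Euc n → ℝ} (hU : ContDiff ℝ 2 U) : Continuous (gradient U) :=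
  (InnerProductSpace.toDual ℝ (Euc n)).symm.continuous.comp
    (hU.continuous_fderiv (by norm_num))

lemma gradient_lipschitz {U : Euc n → ℝ} (hU : ContDiff ℝ 2 U) {b p e W : ℝ} (hb : 0 ≤ b)
    (hp : 0 ≤ p) (hW : 0 < W) {c : Euc n}
    (h2 : ∀ y, ‖iteratedFDeriv ℝ 2 U y‖ ≤ b * (1 + ‖y‖) ^ (-p))
    (hball : ∀ ζ, ‖ζ - c‖ ≤ e → W ≤ 1 + ‖ζ‖) {y z : Euc n} (hy : ‖y - c‖ ≤ e)
    (hz : ‖z - c‖ ≤ e) :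
    ‖gradient U y - gradient U z‖ ≤ b * W ^ (-p) * ‖y - z‖ := by
  have e1 : ‖gradient U y - gradient U z‖ = ‖fderiv ℝ U y - fderiv ℝ U z‖ := by
    unfold gradient
    rw [← map_sub, LinearIsometryEquiv.norm_map]
  rw [e1]
  have hd : ContDiff ℝ 1 (fderiv ℝ U) := hU.fderiv_right (by norm_num)
  refine Convex.norm_image_sub_le_of_norm_fderiv_le (𝕜 := ℝ) (f := fderiv ℝ U)
    (s := Metric.closedBall c e) (fun x _ => (hd.differentiable (by norm_num)) x) ?_
    (convex_closedBall c e) (by simpa [dist_eq_norm] using hz) (by simpa [dist_eq_norm] using hy)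
  intro w hw
  have h3 : ‖fderiv ℝ (fderiv ℝ U) w‖ = ‖iteratedFDeriv ℝ 2 U w‖ := by
    rw [← norm_iteratedFDeriv_fderiv (n := 1), ← norm_iteratedFDeriv_fderiv (n := 0),
      norm_iteratedFDeriv_zero]
  rw [h3]
  refine (h2 w).trans (mul_le_mul_of_nonneg_left ?_ hb)
  exact rpow_le_rpow_of_nonpos hW (hball w (by simpa [dist_eq_norm] using hw)) (by linarith)

/-- Decay of the forces in a tube of radius `κ |t| + c` around the path `γ`. -/
structure Tube (Fl Fs : Euc n → Euc n) (α D V bl1 bl2 bs2 bs3 κ c : ℝ) (γ : ℝ → Euc n) :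
    Prop where
  long_bound : ∀ t a, ‖a - γ t‖ ≤ κ * |t| + c → ‖Fl a‖ ≤ bl1 * (D + V * |t|) ^ (-(α + 1))
  short_bound : ∀ t a, ‖a - γ t‖ ≤ κ * |t| + c → ‖Fs a‖ ≤ bs2 * (D + V * |t|) ^ (-(α + 2))
  long_lipschitz : ∀ t a b, ‖a - γ t‖ ≤ κ * |t| + c → ‖b - γ t‖ ≤ κ * |t| + c →
    ‖Fl a - Fl b‖ ≤ bl2 * (D + V * |t|) ^ (-(α + 2)) * ‖a - b‖
  short_lipschitz : ∀ t a b, ‖a - γ t‖ ≤ κ * |t| + c → ‖b - γ t‖ ≤ κ * |t| + c →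
    ‖Fs a - Fs b‖ ≤ bs3 * (D + V * |t|) ^ (-(α + 3)) * ‖a - b‖

lemma tube_of_decay {α βl0 βl1 βl2 βs1 βs2 βs3 : ℝ} (hα : 0 < α)
    (hβl1 : 0 < βl1) (hβl2 : 0 < βl2) (hβs2 : 0 < βs2) (hβs3 : 0 < βs3)
    {Vl Vs : Euc n → ℝ} (hVl : LongRange α βl0 βl1 βl2 Vl) (hVs : ShortRange α βs1 βs2 βs3 Vs)
    {Fl Fs : Euc n → Euc n} (hFl : ∀ y, Fl y = -gradient Vl y) (hFs : ∀ y, Fs y = -gradient Vs y)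
    {D V κ c : ℝ} {γ : ℝ → Euc n} (hD : 0 < D) (hV : 0 < V)
    (hW : ∀ t a, ‖a - γ t‖ ≤ κ * |t| + c → D + V * |t| ≤ 1 + ‖a‖) :
    Tube Fl Fs α D V βl1 βl2 βs2 βs3 κ c γ := by
  have hpos : ∀ t, 0 < D + V * |t| := fun t => by positivity
  refine ⟨fun t a ha => ?_, fun t a ha => ?_, fun t a b ha hb => ?_, fun t a b ha hb => ?_⟩
  · rw [hFl, norm_neg]
    exact (hVl.2.2.1 a).trans (mul_le_mul_of_nonneg_left
      (rpow_le_rpow_of_nonpos (hpos t) (hW t a ha) (by linarith)) hβl1.le)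
  · rw [hFs, norm_neg]
    exact (hVs.2.2.1 a).trans (mul_le_mul_of_nonneg_left
      (rpow_le_rpow_of_nonpos (hpos t) (hW t a ha) (by linarith)) hβs2.le)
  · rw [hFl, hFl, neg_sub_neg, norm_sub_rev]
    exact gradient_lipschitz hVl.1 hβl2.le (by linarith) (hpos t) hVl.2.2.2 (hW t) ha hb
  · rw [hFs, hFs, neg_sub_neg, norm_sub_rev]
    exact gradient_lipschitz hVs.1 hβs3.le (by linarith) (hpos t) hVs.2.2.2 (hW t) ha hb

lemma norm_free_motion_ge {v x a : Euc n} (h : ⟪v, x⟫ = 0) {t e : ℝ}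
    (ha : ‖a - (t • v + x)‖ ≤ e) :
    ‖x‖ / √2 + ‖v‖ * |t| / √2 - e ≤ ‖a‖ := by
  have h1 : ‖t • v + x‖ ^ 2 = (‖v‖ * |t|) ^ 2 + ‖x‖ ^ 2 := by
    rw [norm_add_sq_real, inner_smul_left, h, norm_smul, norm_eq_abs]
    simp; ring
  have h2 : ‖x‖ / √2 + ‖v‖ * |t| / √2 ≤ ‖t • v + x‖ := by
    rw [← add_div, div_le_iff₀ (by positivity)]
    refine abs_le_of_sq_le_sq' ?_ (by positivity) |>.2
    rw [mul_pow, h1, sq_sqrt (by norm_num)]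
    nlinarith [sq_nonneg (‖x‖ - ‖v‖ * |t|)]
  have h3 := norm_sub_norm_le (t • v + x) a
  rw [norm_sub_rev] at h3
  linarith

end Force

section Past

variable {Fl Fs F : Euc n → Euc n} {zm γ : ℝ → Euc n}
  {α D V bl1 bl2 bs2 bs3 κ r : ℝ}

lemma iterated_Iic_sub {E : Type*} [NormedAddCommGroup E] [NormedSpace ℝ E] [CompleteSpace E]
    {a a' : ℝ} (hD : 0 < D) (hV : 0 < V) (hα : 0 < α) {g g' : ℝ → E}
    (hg : Continuous g) (hg' : Continuous g')
    (h : ∀ τ, τ ≤ 0 → ‖g τ‖ ≤ a * (D + V * |τ|) ^ (-(α + 2)))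
    (h' : ∀ τ, τ ≤ 0 → ‖g' τ‖ ≤ a' * (D + V * |τ|) ^ (-(α + 2))) (t : ℝ) :
    ∫ σ in Iic t, ∫ τ in Iic σ, (g τ - g' τ) =
      (∫ σ in Iic t, ∫ τ in Iic σ, g τ) - ∫ σ in Iic t, ∫ τ in Iic σ, g' τ := by
  obtain ⟨i1, -, i2, -⟩ := iterated_Iic hD hV hα hg h
  obtain ⟨j1, -, j2, -⟩ := iterated_Iic hD hV hα hg' h'
  rw [← integral_sub (i2 t) (j2 t)]
  congr 1; funext σ
  exact integral_sub (i1 σ) (j1 σ)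

lemma iterated_Ici_sub {E : Type*} [NormedAddCommGroup E] [NormedSpace ℝ E] [CompleteSpace E]
    {a a' : ℝ} (hD : 0 < D) (hV : 0 < V) (hα : 0 < α) {g g' : ℝ → E}
    (hg : Continuous g) (hg' : Continuous g')
    (h : ∀ τ, 0 ≤ τ → ‖g τ‖ ≤ a * (D + V * |τ|) ^ (-(α + 2)))
    (h' : ∀ τ, 0 ≤ τ → ‖g' τ‖ ≤ a' * (D + V * |τ|) ^ (-(α + 2))) :
    ∫ σ in Ici 0, ∫ τ in Ici σ, (g τ - g' τ) =
      (∫ σ in Ici 0, ∫ τ in Ici σ, g τ) - ∫ σ in Ici 0, ∫ τ in Ici σ, g' τ := by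
  obtain ⟨i1, -, i2, -⟩ := iterated_Ici hD hV hα hg h
  obtain ⟨j1, -, j2, -⟩ := iterated_Ici hD hV hα hg' h'
  rw [← integral_sub i2 j2]
  congr 1; funext σ
  exact integral_sub (i1 σ) (j1 σ)

/-- The path `zm + f` stays in the tube. -/
lemma MemM.mem_tube (hzm : ∀ t, ‖zm t - γ t‖ ≤ κ * |t|) {f : ℝ → Euc n} (hf : MemM r f) (t : ℝ) :
    ‖zm t + f t - γ t‖ ≤ (κ + r) * |t| + r := by
  have h1 := hf.norm_le t
  have h2 := hzm t
  have h3 := norm_add_le (zm t - γ t) (f t)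
  rw [show zm t + f t - γ t = zm t - γ t + f t by abel]
  linarith

lemma mem_tube_base (hr : 0 ≤ r) (hzm : ∀ t, ‖zm t - γ t‖ ≤ κ * |t|) (t : ℝ) :
    ‖zm t - γ t‖ ≤ (κ + r) * |t| + r := by
  have h2 := hzm t
  have := mul_nonneg hr (abs_nonneg t)
  linarith

lemma norm_forcing_le (hr : 0 ≤ r) (hF : ∀ y, F y = Fl y + Fs y)
    (T : Tube Fl Fs α D V bl1 bl2 bs2 bs3 (κ + r) r γ)
    (hzm : ∀ t, ‖zm t - γ t‖ ≤ κ * |t|) {f : ℝ → Euc n} (hf : MemM r f) (t : ℝ) :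
    ‖F (zm t + f t) - Fl (zm t)‖ ≤ (bs2 + bl2 * ‖f t‖) * (D + V * |t|) ^ (-(α + 2)) := by
  have h1 := T.long_lipschitz t _ _ (hf.mem_tube hzm t) (mem_tube_base hr hzm t)
  have h2 := T.short_bound t _ (hf.mem_tube hzm t)
  rw [add_sub_cancel_left] at h1
  rw [hF, add_sub_right_comm]
  refine (norm_add_le _ _).trans ?_
  linarith

lemma aop_bounds (hD : 0 < D) (hV : 0 < V) (hα : 0 < α) (hbl2 : 0 ≤ bl2) (hr : 0 ≤ r)
    (cFl : Continuous Fl) (cF : Continuous F) (hF : ∀ y, F y = Fl y + Fs y)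
    (T : Tube Fl Fs α D V bl1 bl2 bs2 bs3 (κ + r) r γ) (czm : Continuous zm)
    (hzm : ∀ t, ‖zm t - γ t‖ ≤ κ * |t|) {f : ℝ → Euc n} (hf : MemM r f)
    {Y₀ Y₀' Y₁ : ℝ} (hY₁ : 0 ≤ Y₁) (h₀ : ∀ t ≤ 0, ‖f t‖ ≤ Y₀)
    (h₁ : ∀ t, 0 ≤ t → ‖f t‖ ≤ Y₀' + Y₁ * t) :
    (∀ t, HasDerivAt (Aop Fl F zm 0 f) (∫ τ in Iic t, (F (zm τ + f τ) - Fl (zm τ))) t) ∧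
    (∀ t, t ≤ 0 → ‖Aop Fl F zm 0 f t‖ ≤ (bs2 + bl2 * Y₀) * doubleC α D V) ∧
    ∀ t, 0 ≤ t → ‖Aop Fl F zm 0 f t‖ ≤ (bs2 + bl2 * Y₀) * doubleC α D V +
      ((bs2 + bl2 * Y₀ + (bs2 + bl2 * Y₀')) * singleC α D V + bl2 * Y₁ * linearC α D V) * t := by
  have hw : ∀ t, 0 ≤ (D + V * |t|) ^ (-(α + 2)) := fun t => by positivity
  have hg : Continuous fun τ => F (zm τ + f τ) - Fl (zm τ) :=
    (cF.comp (czm.add hf.1)).sub (cFl.comp czm)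
  have key := iterated_past hD hV hα (mul_nonneg hbl2 hY₁) hg
    (a := bs2 + bl2 * Y₀) (a' := bs2 + bl2 * Y₀')
    (fun t ht => (norm_forcing_le hr hF T hzm hf t).trans
      (mul_le_mul_of_nonneg_right (by have := h₀ t ht; gcongr) (hw t)))
    (fun t ht => (norm_forcing_le hr hF T hzm hf t).trans
      (mul_le_mul_of_nonneg_right (by
        have := mul_le_mul_of_nonneg_left (h₁ t ht) hbl2
        linarith) (hw t)))
  unfold Aop
  simpa only [add_zero] using key

lemma existsUnique_aop_fixedPoint (hD : 0 < D) (hV : 0 < V) (hα : 0 < α) (hbl2 : 0 ≤ bl2)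
    (hbs3 : 0 ≤ bs3) (hr : 0 ≤ r)
    (cFl : Continuous Fl) (cF : Continuous F) (hF : ∀ y, F y = Fl y + Fs y)
    (T : Tube Fl Fs α D V bl1 bl2 bs2 bs3 (κ + r) r γ) (czm : Continuous zm)
    (hzm : ∀ t, ‖zm t - γ t‖ ≤ κ * |t|)
    (hself : 2 * (bs2 + bl2 * r) * doubleC α D V + 2 * (bs2 + bl2 * r) * singleC α D V +
      bl2 * r * linearC α D V ≤ r)
    (hcontr : (bl2 + bs3 / D) * (doubleC α D V + 2 * singleC α D V + linearC α D V) ≤ 1 / 2) :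
    ∃! y, MemM r y ∧ Aop Fl F zm 0 y = y := by
  have hP := doubleC_pos hD hV hα
  have hS := singleC_pos hD hV hα
  have hR := linearC_pos hD hV hα
  have hpos : ∀ t, 0 < D + V * |t| := fun t => by positivity
  have hbs2 : 0 ≤ bs2 + bl2 * r := by
    have h0 := (norm_nonneg _).trans (T.short_bound 0 (γ 0) (by simpa using hr))
    have := nonneg_of_mul_nonneg_left h0 (rpow_pos_of_pos (hpos 0) _)
    positivity
  have hcg : ∀ f, MemM r f → Continuous fun τ => F (zm τ + f τ) - Fl (zm τ) := fun f hf =>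
    (cF.comp (czm.add hf.1)).sub (cFl.comp czm)
  refine existsUnique_fixedPoint_of_contraction hr _ (fun f hf => ?_)
    fun f₁ f₂ hf₁ hf₂ ρ hρ hd => ?_
  · obtain ⟨h1, h2, h3⟩ := aop_bounds hD hV hα hbl2 hr cFl cF hF T czm hzm hf hr
      (fun t ht => hf.norm_le_of_nonpos ht) (fun t ht => (hf.norm_le_of_nonneg ht).trans_eq
        (by ring : r * (1 + t) = r + r * t))
    refine memM_iff.2 ⟨continuous_iff_continuousAt.2 fun t => (h1 t).continuousAt,
      fun t ht u hu => ?_⟩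
    have h4 : ‖Aop Fl F zm 0 f u‖ / (1 + u) ≤ (bs2 + bl2 * r) * doubleC α D V +
        ((bs2 + bl2 * r + (bs2 + bl2 * r)) * singleC α D V + bl2 * r * linearC α D V) := by
      rw [div_le_iff₀ (by linarith)]
      refine (h3 u hu).trans ?_
      have e1 : 0 ≤ (bs2 + bl2 * r) * doubleC α D V := by positivity
      have e2 : 0 ≤ (bs2 + bl2 * r + (bs2 + bl2 * r)) * singleC α D V +
        bl2 * r * linearC α D V := by positivity
      nlinarith [mul_nonneg e1 hu]
    linarith [h2 t ht]
  · let L := bl2 + bs3 / D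
    have hL : 0 ≤ L := by positivity
    let g := fun τ => F (zm τ + f₁ τ) - Fl (zm τ) - (F (zm τ + f₂ τ) - Fl (zm τ))
    have hgb : ∀ τ, ‖g τ‖ ≤ (L * ρ * (1 + max τ 0)) * (D + V * |τ|) ^ (-(α + 2)) := by
      intro τ
      have l1 := T.long_lipschitz τ _ _ (hf₁.mem_tube hzm τ) (hf₂.mem_tube hzm τ)
      have l2 := T.short_lipschitz τ _ _ (hf₁.mem_tube hzm τ) (hf₂.mem_tube hzm τ)
      rw [add_sub_add_left_eq_sub] at l1 l2
      have hw : (D + V * |τ|) ^ (-(α + 3)) ≤ (D + V * |τ|) ^ (-(α + 2)) / D := by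
        rw [show -(α + 3) = -(α + 2) - 1 by ring, rpow_sub_one (hpos τ).ne']
        gcongr
        have := mul_nonneg hV.le (abs_nonneg τ)
        linarith
      have e : g τ = (Fl (zm τ + f₁ τ) - Fl (zm τ + f₂ τ)) +
          (Fs (zm τ + f₁ τ) - Fs (zm τ + f₂ τ)) := by simp only [g, hF]; abel
      rw [e]
      calc _ ≤ _ := norm_add_le _ _
        _ ≤ bl2 * (D + V * |τ|) ^ (-(α + 2)) * ‖f₁ τ - f₂ τ‖ +
            bs3 * ((D + V * |τ|) ^ (-(α + 2)) / D) * ‖f₁ τ - f₂ τ‖ := by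
            refine add_le_add l1 (l2.trans ?_)
            gcongr
        _ = L * ‖f₁ τ - f₂ τ‖ * (D + V * |τ|) ^ (-(α + 2)) := by simp only [L]; ring
        _ ≤ L * (ρ * (1 + max τ 0)) * (D + V * |τ|) ^ (-(α + 2)) := by
            have := hd τ
            gcongr
        _ = _ := by ring
    have hdec : ∀ f, MemM r f → ∀ τ, τ ≤ 0 → ‖F (zm τ + f τ) - Fl (zm τ)‖ ≤
        (bs2 + bl2 * r) * (D + V * |τ|) ^ (-(α + 2)) := by
      intro f hf τ hτ
      have := hf.norm_le_of_nonpos hτ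
      have := hpos τ
      exact (norm_forcing_le hr hF T hzm hf τ).trans (by gcongr)
    have hsub : ∀ t, Aop Fl F zm 0 f₁ t - Aop Fl F zm 0 f₂ t =
        ∫ σ in Iic t, ∫ τ in Iic σ, g τ := by
      intro t
      unfold Aop
      simp only [add_zero]
      exact (iterated_Iic_sub hD hV hα (hcg _ hf₁) (hcg _ hf₂) (hdec _ hf₁) (hdec _ hf₂) t).symm
    obtain ⟨-, h2, h3⟩ := iterated_past hD hV hα (a := L * ρ) (a' := L * ρ) (b := L * ρ)
      (by positivity) ((hcg _ hf₁).sub (hcg _ hf₂))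
      (fun τ hτ => (hgb τ).trans_eq (by rw [max_eq_right hτ, add_zero, mul_one]))
      (fun τ hτ => (hgb τ).trans_eq (by rw [max_eq_left hτ]; ring))
    intro t
    rw [hsub]
    have hfin : L * ρ * (doubleC α D V + 2 * singleC α D V + linearC α D V) ≤ ρ / 2 := by
      have := mul_le_mul_of_nonneg_left hcontr hρ
      simp only [L]
      linarith
    have hLρ : 0 ≤ L * ρ := by positivity
    rcases le_total t 0 with ht | ht
    · rw [max_eq_right ht, add_zero, mul_one]
      refine (h2 t ht).trans (le_trans ?_ hfin)
      gcongr
      linarith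
    · rw [max_eq_left ht]
      refine (h3 t ht).trans (le_trans ?_ (mul_le_mul_of_nonneg_right hfin (by linarith)))
      have := mul_nonneg hLρ hP.le
      have e2 : 0 ≤ L * ρ * (2 * singleC α D V + linearC α D V) := by positivity
      nlinarith [mul_nonneg this ht]

lemma fixedPoint_bounds (hD : 0 < D) (hV : 0 < V) (hα : 0 < α) (hbl2 : 0 ≤ bl2)
    (hbs2 : 0 ≤ bs2) (hr : 0 ≤ r)
    (cFl : Continuous Fl) (cF : Continuous F) (hF : ∀ y, F y = Fl y + Fs y)
    (T : Tube Fl Fs α D V bl1 bl2 bs2 bs3 (κ + r) r γ) (czm : Continuous zm)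
    (hzm : ∀ t, ‖zm t - γ t‖ ≤ κ * |t|)
    (hP40 : bl2 * doubleC α D V ≤ 1 / 40) (hR40 : bl2 * linearC α D V ≤ 1 / 40)
    {y : ℝ → Euc n} (hy : MemM r y) (hA : Aop Fl F zm 0 y = y) :
    (∀ t ≤ 0, ‖y t‖ ≤ 2 * bs2 * doubleC α D V) ∧
    ∀ t, 0 ≤ t → ‖y t‖ ≤ 2 * bs2 * doubleC α D V + 3 * bs2 * singleC α D V * t := by
  have hP := doubleC_pos hD hV hα
  have hS := singleC_pos hD hV hα
  have hR := linearC_pos hD hV hα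
  set P := doubleC α D V
  set S := singleC α D V
  set R := linearC α D V
  have hεP : 0 ≤ bl2 * P := by positivity
  have hεR : 0 ≤ bl2 * R := by positivity
  have ab : ∀ {Y₀ Y₀' Y₁ : ℝ}, 0 ≤ Y₁ → (∀ t ≤ 0, ‖y t‖ ≤ Y₀) →
      (∀ t, 0 ≤ t → ‖y t‖ ≤ Y₀' + Y₁ * t) →
      (∀ t, t ≤ 0 → ‖y t‖ ≤ (bs2 + bl2 * Y₀) * P) ∧
      ∀ t, 0 ≤ t → ‖y t‖ ≤ (bs2 + bl2 * Y₀) * P +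
        ((bs2 + bl2 * Y₀ + (bs2 + bl2 * Y₀')) * S + bl2 * Y₁ * R) * t := by
    intro Y₀ Y₀' Y₁ h1 h2 h3
    have := (aop_bounds hD hV hα hbl2 hr cFl cF hF T czm hzm hy h1 h2 h3).2
    rwa [hA] at this
  have hpos : ∀ t, 0 ≤ t → ‖y t‖ ≤ r + r * t := fun t ht =>
    (hy.norm_le_of_nonneg ht).trans_eq (by ring)
  have h0 : ∀ t ≤ 0, ‖y t‖ ≤ 2 * bs2 * P := by
    have := bootstrap (s := Iic 0) (φ := fun t => ‖y t‖) (q := fun _ => 0) (A := bs2 * P)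
      (A' := 0) (ε := bl2 * P) (B₀ := r) (g₀ := 0) (by positivity) le_rfl hεP (by linarith) hr
      le_rfl (fun t ht => by simpa using hy.norm_le_of_nonpos ht)
      (fun B g _ _ h t ht => by
        have := (ab (Y₀ := B) hr (fun t ht => by simpa using h t ht) hpos).1 t ht
        simp only [mul_zero, add_zero]
        linarith)
    intro t ht
    refine (this t ht).trans ?_
    rw [mul_zero, add_zero, div_le_iff₀ (by linarith)]
    have : 0 ≤ bs2 * P := by positivity
    nlinarith
  refine ⟨h0, ?_⟩
  have hY : (bs2 + bl2 * (2 * bs2 * P)) * P ≤ 2 * bs2 * P := by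
    have : 0 ≤ bs2 * P := by positivity
    nlinarith
  have ha : bs2 + bl2 * (2 * bs2 * P) ≤ 21 / 20 * bs2 := by nlinarith
  have ha0 : 0 ≤ bs2 + bl2 * (2 * bs2 * P) := by positivity
  have := bootstrap (s := Ioi 0) (φ := fun t => (‖y t‖ - 2 * bs2 * P) / t) (q := fun _ => 0)
    (A := 2 * (bs2 + bl2 * (2 * bs2 * P)) * S) (A' := 0) (ε := bl2 * R)
    (B₀ := (bs2 + bl2 * (2 * bs2 * P) + (bs2 + bl2 * r)) * S + bl2 * r * R) (g₀ := 0)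
    (by positivity) le_rfl hεR (by linarith) (by positivity) le_rfl
    (fun t ht => by
      have := (ab hr h0 hpos).2 t (le_of_lt ht)
      rw [mul_zero, add_zero, div_le_iff₀ ht]
      linarith)
    (fun B g hB _ h t ht => by
      have := (ab (Y₀ := 2 * bs2 * P) (Y₀' := 2 * bs2 * P) (Y₁ := B) hB h0 (fun u hu => by
        rcases hu.eq_or_lt with rfl | hu
        · simpa using h0 0 le_rfl
        · have := h u hu
          rw [mul_zero, add_zero, div_le_iff₀ hu] at this
          linarith)).2 t (le_of_lt ht)
      rw [mul_zero, add_zero, div_le_iff₀ ht]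
      linarith)
  intro t ht
  rcases ht.eq_or_lt with rfl | ht
  · simpa using h0 0 le_rfl
  · have h4 := this t ht
    have h5 : 2 * (bs2 + bl2 * (2 * bs2 * P)) * S / (1 - bl2 * R) ≤ 3 * bs2 * S := by
      rw [div_le_iff₀ (by linarith)]
      have e1 := mul_le_mul_of_nonneg_right ha hS.le
      have : 0 ≤ bs2 * S := by positivity
      nlinarith
    rw [mul_zero, add_zero] at h4
    have h6 := h4.trans h5
    rw [div_le_iff₀ ht] at h6
    linarith

end Past

section Ode

variable {E : Type*} [NormedAddCommGroup E] [NormedSpace ℝ E]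
  {D V p a : ℝ}

lemma integrableOn_Ici_of_decay (hD : 0 < D) (hV : 0 < V) (hp : 0 < p) {g : ℝ → E}
    (hg : Continuous g) (h : ∀ τ, 0 ≤ τ → ‖g τ‖ ≤ a * (D + V * |τ|) ^ (-(p + 1))) (t : ℝ) :
    IntegrableOn g (Ici t) :=
  (tail_bound hD hV hp hg fun τ hτ => by simpa [abs_of_nonneg hτ] using h τ hτ).1 t

lemma integrableOn_Iic_of_decay (hD : 0 < D) (hV : 0 < V) (hp : 0 < p) {g : ℝ → E}
    (hg : Continuous g) (h : ∀ τ, τ ≤ 0 → ‖g τ‖ ≤ a * (D + V * |τ|) ^ (-(p + 1))) (t : ℝ) :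
    IntegrableOn g (Iic t) := by
  have := integrableOn_Ici_of_decay hD hV hp (g := fun τ => g (-τ)) (hg.comp continuous_neg)
    (fun τ hτ => by simpa using h (-τ) (by simpa using hτ)) (-t)
  simpa using this.comp_neg_Iic

lemma norm_integral_Ici_le_of_decay (hD : 0 < D) (hV : 0 < V) (hp : 0 < p) {g : ℝ → E}
    (hg : Continuous g) (h : ∀ τ, 0 ≤ τ → ‖g τ‖ ≤ a * (D + V * |τ|) ^ (-(p + 1))) :
    ‖∫ τ in Ici 0, g τ‖ ≤ a / (p * V) * D ^ (-p) := by
  simpa using (tail_bound hD hV hp hg fun τ hτ => by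
    simpa [abs_of_nonneg hτ] using h τ hτ).2 0 le_rfl

lemma norm_integral_Iic_le_of_decay (hD : 0 < D) (hV : 0 < V) (hp : 0 < p) {g : ℝ → E}
    (hg : Continuous g) (h : ∀ τ, τ ≤ 0 → ‖g τ‖ ≤ a * (D + V * |τ|) ^ (-(p + 1))) :
    ‖∫ τ in Iic 0, g τ‖ ≤ a / (p * V) * D ^ (-p) := by
  rw [integral_Iic_eq_Ici_neg, neg_zero]
  exact norm_integral_Ici_le_of_decay hD hV hp (hg.comp continuous_neg)
    (fun τ hτ => by simpa using h (-τ) (by simpa using hτ))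

lemma integral_eq_Iic_add_Ici {g : ℝ → E} (h : ∀ t, IntegrableOn g (Iic t))
    (h' : ∀ t, IntegrableOn g (Ici t)) (t : ℝ) :
    ∫ τ, g τ = (∫ τ in Iic t, g τ) + ∫ τ in Ici t, g τ := by
  rw [integral_Ici_eq_integral_Ioi, ← intervalIntegral.integral_Iic_add_Ioi (h t)
    ((h' t).mono_set Ioi_subset_Ici_self)]

variable [CompleteSpace E]

/-- A trajectory with prescribed velocity at `-∞` is driven by the past force. -/
lemma hasDerivAt_of_tendsto_atBot {z G : ℝ → E} {v : E} (hz : ContDiff ℝ 2 z)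
    (hG : ∀ t, deriv (deriv z) t = G t) (hv : Tendsto (fun t => deriv z t) atBot (𝓝 v))
    (hi : ∀ t, IntegrableOn G (Iic t)) (t : ℝ) :
    HasDerivAt z (v + ∫ τ in Iic t, G τ) t := by
  have h1 : ContDiff ℝ 1 (deriv z) := ((contDiff_succ_iff_deriv (n := 1)).1 hz).2.2
  have h2 : ∀ t, HasDerivAt (deriv z) (G t) t := fun t =>
    hG t ▸ (h1.differentiable (by norm_num) t).hasDerivAt
  rw [integral_Iic_of_hasDerivAt_of_tendsto' (fun u _ => h2 u) (hi t) hv, add_sub_cancel]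
  exact (hz.differentiable (by norm_num) t).hasDerivAt

/-- A trajectory with prescribed velocity at `+∞` is driven by the future force. -/
lemma hasDerivAt_of_tendsto_atTop {z G : ℝ → E} {v : E} (hz : ContDiff ℝ 2 z)
    (hG : ∀ t, deriv (deriv z) t = G t) (hv : Tendsto (fun t => deriv z t) atTop (𝓝 v))
    (hi : ∀ t, IntegrableOn G (Ici t)) (t : ℝ) :
    HasDerivAt z (v - ∫ τ in Ici t, G τ) t := by
  have h1 : ContDiff ℝ 1 (deriv z) := ((contDiff_succ_iff_deriv (n := 1)).1 hz).2.2
  have h2 : ∀ t, HasDerivAt (deriv z) (G t) t := fun t =>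
    hG t ▸ (h1.differentiable (by norm_num) t).hasDerivAt
  rw [integral_Ici_eq_integral_Ioi, integral_Ioi_of_hasDerivAt_of_tendsto' (fun u _ => h2 u)
    ((hi t).mono_set Ioi_subset_Ici_self) hv, sub_sub_cancel]
  exact (hz.differentiable (by norm_num) t).hasDerivAt

end Ode

section Future

variable {E : Type*} [NormedAddCommGroup E] [NormedSpace ℝ E] [CompleteSpace E]
  {α D V b l : ℝ}

/-- A difference of trajectories with equal velocities at `+∞`, driven by a decaying Lipschitz
force, stays bounded on `[0, ∞)`. -/
lemma future_difference_uniform (hD : 0 < D) (hV : 0 < V) (hα : 0 < α) (hb : 0 ≤ b) (hl : 0 ≤ l)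
    (hlR : l * linearC α D V < 1) (hα1 : doubleC α D V ≤ linearC α D V)
    {d g : ℝ → E} (hg : Continuous g)
    (hgd : ∀ τ, 0 ≤ τ → ‖g τ‖ ≤ (b + l * ‖d τ‖) * (D + V * |τ|) ^ (-(α + 2)))
    (hd : ∀ t, 0 ≤ t → HasDerivAt d (-∫ τ in Ici t, g τ) t)
    {B₀ g₀ : ℝ} (hB₀ : 0 ≤ B₀) (hg₀ : 0 ≤ g₀) (h0 : ∀ t, 0 ≤ t → ‖d t‖ ≤ B₀ + g₀ * t)
    {t : ℝ} (ht : 0 ≤ t) :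
    ‖d t‖ ≤ (‖d 0‖ + b * doubleC α D V) / (1 - l * linearC α D V) := by
  have hP := doubleC_pos hD hV hα
  have hR := linearC_pos hD hV hα
  have := bootstrap (s := Ici 0) (φ := fun t => ‖d t‖) (q := fun t => t)
    (A := ‖d 0‖ + b * doubleC α D V) (A' := 0) (ε := l * linearC α D V) (by positivity) le_rfl
    (by positivity) hlR hB₀ hg₀ h0 (fun B g' hB hg' h t ht => by
      have := future_difference_bound hD hV hα (a := b + l * B) (b := l * g') (by positivity) hg
        (fun τ hτ => (hgd τ hτ).trans (by
          have h3 := mul_le_mul_of_nonneg_left (h τ hτ) hl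
          refine mul_le_mul_of_nonneg_right ?_ (by positivity)
          linarith)) hd ht
      have h4 := mul_le_mul_of_nonneg_left hα1 (mul_nonneg hl hB)
      have ht' : 0 ≤ t := ht
      have e : (b + l * B) * doubleC α D V = b * doubleC α D V + l * B * doubleC α D V := by ring
      have e2 : l * linearC α D V * B = l * B * linearC α D V := by ring
      have e3 : l * g' * linearC α D V * t = l * linearC α D V * g' * t := by ring
      rw [zero_add]
      linarith) t ht
  simpa using this

end Future

section Scattering

variable {Fl Fs F : Euc n → Euc n} {zm z zp u γ : ℝ → Euc n}
  {α D V bl1 bl2 bs2 bs3 K c : ℝ}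

lemma norm_force_sub_long_le (hF : ∀ y, F y = Fl y + Fs y)
    (T : Tube Fl Fs α D V bl1 bl2 bs2 bs3 K c γ) {t : ℝ} {a b : Euc n}
    (ha : ‖a - γ t‖ ≤ K * |t| + c) (hb : ‖b - γ t‖ ≤ K * |t| + c) :
    ‖F a - Fl b‖ ≤ (bs2 + bl2 * ‖a - b‖) * (D + V * |t|) ^ (-(α + 2)) := by
  have h1 := T.long_lipschitz t _ _ ha hb
  have h2 := T.short_bound t _ ha
  rw [hF, add_sub_right_comm]
  refine (norm_add_le _ _).trans ?_
  linarith

/-- The short range force along a perturbed free motion is close to the one along the free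
motion. -/
lemma norm_short_sub_le (hD : 0 < D) (hV : 0 < V) (hK : 0 ≤ K) (hc : 0 ≤ c) (hbs3 : 0 ≤ bs3)
    (T : Tube Fl Fs α D V bl1 bl2 bs2 bs3 K c γ) {t : ℝ} {a : Euc n}
    (ha : ‖a - γ t‖ ≤ K * |t| + c) {e : ℝ} (he : ‖a - γ t‖ ≤ e * (D + V * |t|)) :
    ‖Fs a - Fs (γ t)‖ ≤ bs3 * e * (D + V * |t|) ^ (-(α + 2)) := by
  have hpos : 0 < D + V * |t| := by positivity
  have hγ : ‖γ t - γ t‖ ≤ K * |t| + c := by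
    rw [sub_self, norm_zero]; positivity
  refine (T.short_lipschitz t _ _ ha hγ).trans ?_
  have h1 : (D + V * |t|) ^ (-(α + 2)) = (D + V * |t|) ^ (-(α + 3)) * (D + V * |t|) := by
    rw [show -(α + 2) = -(α + 3) + 1 by ring, rpow_add_one hpos.ne']
  rw [h1]
  calc _ ≤ bs3 * (D + V * |t|) ^ (-(α + 3)) * (e * (D + V * |t|)) := by gcongr
    _ = _ := by ring

/-- A force of long plus short range is integrable along a trajectory in the tube. -/
lemma integrableOn_force (hD : 0 < D) (hV : 0 < V) (hα : 0 < α)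
    (cFl : Continuous Fl) (cFs : Continuous Fs) (hF : ∀ y, F y = Fl y + Fs y)
    (T : Tube Fl Fs α D V bl1 bl2 bs2 bs3 K c γ) (cz : Continuous z)
    (hz : ∀ t, ‖z t - γ t‖ ≤ K * |t| + c) :
    (∀ t, IntegrableOn (fun τ => F (z τ)) (Iic t)) ∧
    (∀ t, IntegrableOn (fun τ => F (z τ)) (Ici t)) ∧
    ‖∫ τ, F (z τ)‖ ≤ 2 * (bl1 * (D ^ (-α) / (α * V)) + bs2 * singleC α D V) := by
  have cl : Continuous fun τ => Fl (z τ) := cFl.comp cz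
  have cs : Continuous fun τ => Fs (z τ) := cFs.comp cz
  have hl := fun τ => T.long_bound τ _ (hz τ)
  have hs := fun τ => T.short_bound τ _ (hz τ)
  have i1 := integrableOn_Iic_of_decay hD hV hα cl fun τ _ => hl τ
  have i2 := integrableOn_Ici_of_decay hD hV hα cl fun τ _ => hl τ
  obtain ⟨j1, n1, -⟩ := iterated_Iic hD hV hα cs fun τ _ => hs τ
  obtain ⟨j2, n2, -⟩ := iterated_Ici hD hV hα cs fun τ _ => hs τ
  have m1 := norm_integral_Iic_le_of_decay hD hV hα cl fun τ _ => hl τ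
  have m2 := norm_integral_Ici_le_of_decay hD hV hα cl fun τ _ => hl τ
  have k1 : ∀ t, IntegrableOn (fun τ => F (z τ)) (Iic t) := fun t => by
    simp only [hF]; exact (i1 t).add (j1 t)
  have k2 : ∀ t, IntegrableOn (fun τ => F (z τ)) (Ici t) := fun t => by
    simp only [hF]; exact (i2 t).add (j2 t)
  refine ⟨k1, k2, ?_⟩
  rw [integral_eq_Iic_add_Ici k1 k2 0]
  simp only [hF]
  rw [integral_add (i1 0) (j1 0), integral_add (i2 0) (j2 0)]
  have e : bl1 / (α * V) * D ^ (-α) = bl1 * (D ^ (-α) / (α * V)) := by ring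
  rw [e] at m1 m2
  refine (norm_add_le _ _).trans ?_
  have a1 := norm_add_le (∫ τ in Iic 0, Fl (z τ)) (∫ τ in Iic 0, Fs (z τ))
  have a2 := norm_add_le (∫ τ in Ici 0, Fl (z τ)) (∫ τ in Ici 0, Fs (z τ))
  linarith

/-- The trajectory `z` differs from the free solution `zp` with the same velocity at `+∞` by a
solution of a decaying equation. -/
lemma hasDerivAt_scattering_difference (hD : 0 < D) (hV : 0 < V) (hα : 0 < α)
    (cFl : Continuous Fl) (cFs : Continuous Fs) (hF : ∀ y, F y = Fl y + Fs y)
    (T : Tube Fl Fs α D V bl1 bl2 bs2 bs3 K c γ)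
    {v x x' : Euc n} {C C' : ℝ} (hzm : IsFreeSol Fl x v atBot C zm)
    (tzm : ∀ t, ‖zm t - γ t‖ ≤ K * |t| + c)
    (cz : Continuous z) (tz : ∀ t, ‖z t - γ t‖ ≤ K * |t| + c)
    (hz : ∀ t, HasDerivAt (fun t => z t - zm t) (∫ τ in Iic t, (F (z τ) - Fl (zm τ))) t)
    (hzp : IsFreeSol Fl x' (v + ∫ τ, F (z τ)) atTop C' zp)
    (tzp : ∀ t, 0 ≤ t → ‖zp t - γ t‖ ≤ K * |t| + c) (t : ℝ) :
    HasDerivAt (fun t => z t - zp t) (-∫ τ in Ici t, (F (z τ) - Fl (zp τ))) t := by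
  obtain ⟨k1, k2, -⟩ := integrableOn_force hD hV hα cFl cFs hF T cz tz
  have im : ∀ t, IntegrableOn (fun τ => Fl (zm τ)) (Iic t) := integrableOn_Iic_of_decay hD hV hα (cFl.comp hzm.1.continuous)
    fun τ _ => T.long_bound τ _ (tzm τ)
  have ip : ∀ t, IntegrableOn (fun τ => Fl (zp τ)) (Ici t) := integrableOn_Ici_of_decay hD hV hα (cFl.comp hzp.1.continuous)
    fun τ hτ => T.long_bound τ _ (tzp τ hτ)
  have d1 := hasDerivAt_of_tendsto_atBot hzm.1 hzm.2.1 hzm.2.2.2.1 im t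
  have d2 := hasDerivAt_of_tendsto_atTop hzp.1 hzp.2.1 hzp.2.2.2.1 ip t
  have d3 := ((hz t).add d1).sub d2
  refine (d3.congr_of_eventuallyEq (Eventually.of_forall fun u => ?_)).congr_deriv ?_
  · simp
  · rw [integral_sub (k1 t) (im t), integral_sub (k2 t) (ip t), integral_eq_Iic_add_Ici k1 k2 t]
    abel

/-- Uniform bound on the difference between the trajectory `z` and the free solution `zp`. -/
lemma norm_scattering_difference_le (hD : 0 < D) (hV : 0 < V) (hα : 0 < α) (hK : 0 ≤ K)
    (hc : 0 ≤ c) (hbl2 : 0 ≤ bl2) (hbs2 : 0 ≤ bs2)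
    (hR : bl2 * linearC α D V ≤ 1 / 20)
    (cFl : Continuous Fl) (cFs : Continuous Fs) (hF : ∀ y, F y = Fl y + Fs y)
    (T : Tube Fl Fs α D V bl1 bl2 bs2 bs3 K c γ)
    {v x x' : Euc n} {C C' : ℝ} (hzm : IsFreeSol Fl x v atBot C zm)
    (tzm : ∀ t, ‖zm t - γ t‖ ≤ K * |t| + c)
    (cz : Continuous z) (tz : ∀ t, ‖z t - γ t‖ ≤ K * |t| + c)
    (hz : ∀ t, HasDerivAt (fun t => z t - zm t) (∫ τ in Iic t, (F (z τ) - Fl (zm τ))) t)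
    (hzp : IsFreeSol Fl x' (v + ∫ τ, F (z τ)) atTop C' zp)
    (tzp : ∀ t, 0 ≤ t → ‖zp t - γ t‖ ≤ K * |t| + c) {t : ℝ} (ht : 0 ≤ t) :
    ‖z t - zp t‖ ≤ 20 / 19 * (‖z 0 - x'‖ + bs2 * doubleC α D V) := by
  have hP := doubleC_pos hD hV hα
  have cF : Continuous F := by
    rw [show F = fun y => Fl y + Fs y from funext hF]; exact cFl.add cFs
  have hPR : doubleC α D V ≤ linearC α D V := by
    unfold doubleC linearC
    have : 0 < D ^ (-α) := by positivity
    apply div_le_div_of_nonneg_left (by positivity) (by positivity)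
    nlinarith [mul_pos hα hα, sq_nonneg V, mul_nonneg (mul_pos hα hα).le (sq_nonneg V)]
  have key := future_difference_uniform hD hV hα (b := bs2) (l := bl2) hbs2 hbl2 (by linarith) hPR
    (d := fun t => z t - zp t) (g := fun τ => F (z τ) - Fl (zp τ))
    ((cF.comp cz).sub (cFl.comp hzp.1.continuous))
    (fun τ hτ => norm_force_sub_long_le hF T (tz τ) (tzp τ hτ))
    (fun t _ => hasDerivAt_scattering_difference hD hV hα cFl cFs hF T hzm tzm cz tz hz hzp tzp t)
    (B₀ := 2 * c) (g₀ := 2 * K) (by positivity) (by positivity) (fun t ht => by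
      have h1 := tz t
      have h2 := tzp t ht
      rw [abs_of_nonneg ht] at h1 h2
      have h3 := norm_sub_le (z t - γ t) (zp t - γ t)
      rw [sub_sub_sub_cancel_right] at h3
      linarith) ht
  simp only [hzp.2.2.1] at key
  refine key.trans ?_
  rw [div_le_iff₀ (by linarith)]
  have : 0 ≤ ‖z 0 - x'‖ + bs2 * doubleC α D V := by positivity
  nlinarith

section Estimates

variable {e Y B : ℝ}

lemma norm_past_remainder_le (hD : 0 < D) (hV : 0 < V) (hK : 0 ≤ K) (hc : 0 ≤ c)
    (hbl2 : 0 ≤ bl2) (hbs3 : 0 ≤ bs3)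
    (hF : ∀ y, F y = Fl y + Fs y)
    (T : Tube Fl Fs α D V bl1 bl2 bs2 bs3 K c γ) {t : ℝ}
    (tz : ‖z t - γ t‖ ≤ K * |t| + c) (tu : ‖u t - γ t‖ ≤ K * |t| + c)
    (he : ‖z t - γ t‖ ≤ e * (D + V * |t|)) (hB : ‖z t - u t‖ ≤ B) :
    ‖F (z t) - Fl (u t) - Fs (γ t)‖ ≤ (bs3 * e + bl2 * B) * (D + V * |t|) ^ (-(α + 2)) := by
  have hpos : 0 < D + V * |t| := by positivity
  have h1 := norm_short_sub_le hD hV hK hc hbs3 T tz he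
  have h2 := (T.long_lipschitz t _ _ tz tu).trans
    (mul_le_mul_of_nonneg_left hB (by positivity))
  rw [hF, show Fl (z t) + Fs (z t) - Fl (u t) - Fs (γ t) =
    (Fs (z t) - Fs (γ t)) + (Fl (z t) - Fl (u t)) by abel]
  refine (norm_add_le _ _).trans ?_
  linarith

/-- High energy asymptotics of the scattered velocity. -/
lemma norm_velocity_remainder_le (hD : 0 < D) (hV : 0 < V) (hα : 0 < α) (hK : 0 ≤ K)
    (hc : 0 ≤ c) (hbl2 : 0 ≤ bl2) (hbs3 : 0 ≤ bs3)
    (cFl : Continuous Fl) (cFs : Continuous Fs) (hF : ∀ y, F y = Fl y + Fs y)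
    (T : Tube Fl Fs α D V bl1 bl2 bs2 bs3 K c γ) (cγ : Continuous γ)
    (czm : Continuous zm) (czp : Continuous zp) (cz : Continuous z)
    (tzm : ∀ t, ‖zm t - γ t‖ ≤ K * |t| + c) (tz : ∀ t, ‖z t - γ t‖ ≤ K * |t| + c)
    (tzp : ∀ t, 0 ≤ t → ‖zp t - γ t‖ ≤ K * |t| + c)
    (he : ∀ t, ‖z t - γ t‖ ≤ e * (D + V * |t|)) (hY : ∀ t ≤ 0, ‖z t - zm t‖ ≤ Y)
    (hB : ∀ t, 0 ≤ t → ‖z t - zp t‖ ≤ B) :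
    ‖(∫ τ, F (z τ)) - Wtilde Fl zm zp - ∫ τ, Fs (γ τ)‖ ≤
      (2 * bs3 * e + bl2 * (Y + B)) * singleC α D V := by
  have cF : Continuous F := by
    rw [show F = fun y => Fl y + Fs y from funext hF]; exact cFl.add cFs
  have tγ : ∀ t, ‖γ t - γ t‖ ≤ K * |t| + c := fun t => by
    rw [sub_self, norm_zero]; positivity
  obtain ⟨k1, k2, -⟩ := integrableOn_force hD hV hα cFl cFs hF T cz tz
  have im : ∀ t, IntegrableOn (fun τ => Fl (zm τ)) (Iic t) := integrableOn_Iic_of_decay hD hV hα (cFl.comp czm)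
    fun τ _ => T.long_bound τ _ (tzm τ)
  have ip : ∀ t, IntegrableOn (fun τ => Fl (zp τ)) (Ici t) := integrableOn_Ici_of_decay hD hV hα (cFl.comp czp)
    fun τ hτ => T.long_bound τ _ (tzp τ hτ)
  have cs : Continuous fun τ => Fs (γ τ) := cFs.comp cγ
  obtain ⟨s1, -⟩ := iterated_Iic hD hV hα cs fun τ _ => T.short_bound τ _ (tγ τ)
  obtain ⟨s2, -⟩ := iterated_Ici hD hV hα cs fun τ _ => T.short_bound τ _ (tγ τ)
  have b1 := (iterated_Iic (g := fun τ => F (z τ) - Fl (zm τ) - Fs (γ τ)) hD hV hα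
    (((cF.comp cz).sub (cFl.comp czm)).sub cs)
    fun τ hτ => norm_past_remainder_le hD hV hK hc hbl2 hbs3 hF T (tz τ) (tzm τ) (he τ)
      (hY τ hτ)).2.1
  have b2 := (iterated_Ici (g := fun τ => F (z τ) - Fl (zp τ) - Fs (γ τ)) hD hV hα
    (((cF.comp cz).sub (cFl.comp czp)).sub cs)
    fun τ hτ => norm_past_remainder_le hD hV hK hc hbl2 hbs3 hF T (tz τ) (tzp τ hτ) (he τ)
      (hB τ hτ)).2.1
  have e1 : (∫ τ, F (z τ)) - Wtilde Fl zm zp - ∫ τ, Fs (γ τ) =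
      (∫ τ in Iic 0, (F (z τ) - Fl (zm τ) - Fs (γ τ))) +
        ∫ τ in Ici 0, (F (z τ) - Fl (zp τ) - Fs (γ τ)) := by
    rw [integral_sub (f := fun τ => F (z τ) - Fl (zm τ)) ((k1 0).sub (im 0)) (s1 0),
      integral_sub (f := fun τ => F (z τ) - Fl (zp τ)) ((k2 0).sub (ip 0)) (s2 0),
      integral_sub (k1 0) (im 0), integral_sub (k2 0) (ip 0), integral_eq_Iic_add_Ici k1 k2 0,
      integral_eq_Iic_add_Ici s1 s2 0]
    simp only [Wtilde]
    abel
  rw [e1]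
  refine (norm_add_le _ _).trans ((add_le_add b1 b2).trans_eq ?_)
  ring

/-- High energy asymptotics of the scattered position. -/
lemma norm_position_remainder_le (hD : 0 < D) (hV : 0 < V) (hα : 0 < α) (hK : 0 ≤ K)
    (hc : 0 ≤ c) (hbl2 : 0 ≤ bl2) (hbs3 : 0 ≤ bs3)
    (cFl : Continuous Fl) (cFs : Continuous Fs) (hF : ∀ y, F y = Fl y + Fs y)
    (T : Tube Fl Fs α D V bl1 bl2 bs2 bs3 K c γ) (cγ : Continuous γ)
    (czm : Continuous zm) (czp : Continuous zp) (cz : Continuous z)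
    (tzm : ∀ t, ‖zm t - γ t‖ ≤ K * |t| + c) (tz : ∀ t, ‖z t - γ t‖ ≤ K * |t| + c)
    (tzp : ∀ t, 0 ≤ t → ‖zp t - γ t‖ ≤ K * |t| + c)
    (he : ∀ t, ‖z t - γ t‖ ≤ e * (D + V * |t|)) (hY : ∀ t ≤ 0, ‖z t - zm t‖ ≤ Y)
    (hB : ∀ t, 0 ≤ t → ‖z t - zp t‖ ≤ B) {b : Euc n}
    (hb : b = (∫ σ in Iic (0 : ℝ), ∫ τ in Iic σ, (F (z τ) - Fl (zm τ))) -
      (∫ σ in Ici (0 : ℝ), ∫ τ in Ici σ, Fs (z τ)) -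
      ∫ σ in Ici (0 : ℝ), ∫ τ in Ici σ, (Fl (z τ) - Fl (zp τ))) :
    ‖b - (∫ σ in Iic (0 : ℝ), ∫ τ in Iic σ, Fs (γ τ)) +
        ∫ σ in Ici (0 : ℝ), ∫ τ in Ici σ, Fs (γ τ)‖ ≤
      (2 * bs3 * e + bl2 * (Y + B)) * doubleC α D V := by
  have cF : Continuous F := by
    rw [show F = fun y => Fl y + Fs y from funext hF]; exact cFl.add cFs
  have tγ : ∀ t, ‖γ t - γ t‖ ≤ K * |t| + c := fun t => by
    rw [sub_self, norm_zero]; positivity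
  have hpos : ∀ t, 0 < D + V * |t| := fun t => by positivity
  have cs : Continuous fun τ => Fs (γ τ) := cFs.comp cγ
  have cm : Continuous fun τ => F (z τ) - Fl (zm τ) := (cF.comp cz).sub (cFl.comp czm)
  have cp : Continuous fun τ => Fl (z τ) - Fl (zp τ) := (cFl.comp cz).sub (cFl.comp czp)
  have bm : ∀ τ, τ ≤ 0 → ‖F (z τ) - Fl (zm τ)‖ ≤
      (bs2 + bl2 * Y) * (D + V * |τ|) ^ (-(α + 2)) := fun τ hτ => by
    have := hpos τ
    have := hY τ hτ
    exact (norm_force_sub_long_le hF T (tz τ) (tzm τ)).trans (by gcongr)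
  have b1 := (iterated_Iic (g := fun τ => F (z τ) - Fl (zm τ) - Fs (γ τ)) hD hV hα (cm.sub cs)
    fun τ hτ => norm_past_remainder_le hD hV hK hc hbl2 hbs3 hF T (tz τ) (tzm τ) (he τ)
      (hY τ hτ)).2.2.2 0 le_rfl
  have b2 := (iterated_Ici (g := fun τ => Fs (z τ) - Fs (γ τ)) hD hV hα ((cFs.comp cz).sub cs)
    fun τ _ => norm_short_sub_le hD hV hK hc hbs3 T (tz τ) (he τ)).2.2.2
  have b3 := (iterated_Ici (a := bl2 * B) hD hV hα cp fun τ hτ => by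
    have := hpos τ
    have := hB τ hτ
    refine (T.long_lipschitz τ _ _ (tz τ) (tzp τ hτ)).trans ?_
    rw [mul_right_comm]
    gcongr).2.2.2
  have e1 := iterated_Iic_sub hD hV hα cm cs bm (fun τ _ => T.short_bound τ _ (tγ τ)) 0
  have e2 := iterated_Ici_sub hD hV hα (cFs.comp cz) cs (fun τ _ => T.short_bound τ _ (tz τ))
    (fun τ _ => T.short_bound τ _ (tγ τ))
  simp only [Function.comp_apply] at e2
  rw [e1] at b1
  rw [e2] at b2
  rw [hb]
  generalize (∫ σ in Iic (0 : ℝ), ∫ τ in Iic σ, (F (z τ) - Fl (zm τ))) = I₁ at *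
  generalize (∫ σ in Iic (0 : ℝ), ∫ τ in Iic σ, Fs (γ τ)) = I₂ at *
  generalize (∫ σ in Ici (0 : ℝ), ∫ τ in Ici σ, Fs (z τ)) = I₃ at *
  generalize (∫ σ in Ici (0 : ℝ), ∫ τ in Ici σ, Fs (γ τ)) = I₄ at *
  generalize (∫ σ in Ici (0 : ℝ), ∫ τ in Ici σ, (Fl (z τ) - Fl (zp τ))) = I₅ at *
  rw [show I₁ - I₃ - I₅ - I₂ + I₄ = (I₁ - I₂) - (I₃ - I₄) - I₅ by abel]
  have t1 := norm_sub_le (I₁ - I₂ - (I₃ - I₄)) I₅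
  have t2 := norm_sub_le (I₁ - I₂) (I₃ - I₄)
  linarith

/-- A fixed point of the position map is small. -/
lemma norm_sub_position_le (hD : 0 < D) (hV : 0 < V) (hα : 0 < α)
    (hbl2 : 0 ≤ bl2)
    (cFl : Continuous Fl) (cFs : Continuous Fs)
    (T : Tube Fl Fs α D V bl1 bl2 bs2 bs3 K c γ)
    (czp : Continuous zp) (cz : Continuous z)
    (tz : ∀ t, ‖z t - γ t‖ ≤ K * |t| + c)
    (tzp : ∀ t, 0 ≤ t → ‖zp t - γ t‖ ≤ K * |t| + c)
    (hB : ∀ t, 0 ≤ t → ‖z t - zp t‖ ≤ B) {b y : Euc n}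
    (hb : b = y - (∫ σ in Ici (0 : ℝ), ∫ τ in Ici σ, Fs (z τ)) -
      ∫ σ in Ici (0 : ℝ), ∫ τ in Ici σ, (Fl (z τ) - Fl (zp τ))) :
    ‖y - b‖ ≤ (bs2 + bl2 * B) * doubleC α D V := by
  have hpos : ∀ t, 0 < D + V * |t| := fun t => by positivity
  have b1 := (iterated_Ici (g := fun τ => Fs (z τ)) hD hV hα (cFs.comp cz)
    fun τ _ => T.short_bound τ _ (tz τ)).2.2.2
  have b3 := (iterated_Ici (g := fun τ => Fl (z τ) - Fl (zp τ)) (a := bl2 * B) hD hV hα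
    ((cFl.comp cz).sub (cFl.comp czp)) fun τ hτ => by
      have := hpos τ
      have := hB τ hτ
      refine (T.long_lipschitz τ _ _ (tz τ) (tzp τ hτ)).trans ?_
      rw [mul_right_comm]
      gcongr).2.2.2
  rw [hb, sub_sub, sub_sub_cancel]
  refine (norm_add_le _ _).trans ?_
  linarith

end Estimates

end Scattering

section Constants

variable {α D V : ℝ}

lemma linearC_eq (hV : 0 < V) (hα : 0 < α) :
    linearC α D V = (α + 1) * doubleC α D V := by
  unfold linearC doubleC; field_simp

lemma singleC_eq (hD : 0 < D) (hV : 0 < V) (hα : 0 < α) :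
    singleC α D V = α * V * doubleC α D V / D := by
  unfold singleC doubleC
  rw [show -(α + 1) = -α - 1 by ring, rpow_sub_one hD.ne']
  field_simp

lemma rpow_mul_rpow_neg_le_one {E : ℝ} (hE : 0 < E) (hED : E ≤ D) (hα : 0 < α) :
    E ^ α * D ^ (-α) ≤ 1 := by
  have hD : 0 < D := hE.trans_le hED
  rw [rpow_neg hD.le, ← div_eq_mul_inv, div_le_one (by positivity)]
  exact rpow_le_rpow hE.le hED hα.le

lemma mul_linearC_le_of_le {E b k : ℝ} (hE : 0 < E) (hED : E ≤ D) (hα : 0 < α) (hV : 0 < V)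
    (hk : 0 ≤ k) (h : b ≤ k * (α * V ^ 2 * E ^ α)) : b * linearC α D V ≤ k := by
  have hD : 0 < D := hE.trans_le hED
  have h1 := rpow_mul_rpow_neg_le_one hE hED hα
  unfold linearC
  rw [← mul_div_assoc, div_le_iff₀ (by positivity)]
  calc b * D ^ (-α) ≤ k * (α * V ^ 2 * E ^ α) * D ^ (-α) := by gcongr
    _ = k * (α * V ^ 2) * (E ^ α * D ^ (-α)) := by ring
    _ ≤ k * (α * V ^ 2) * 1 := by gcongr
    _ = _ := mul_one _

lemma mul_singleC_le_of_le {E b k : ℝ} (hE : 0 < E) (hED : E ≤ D) (hα : 0 < α) (hα1 : α ≤ 1)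
    (hV : 0 < V) (hk : 0 ≤ k) (h : b ≤ k * (α * V * E ^ α)) :
    b * singleC α D V ≤ k / (2 * D) := by
  have hD : 0 < D := hE.trans_le hED
  have h1 := rpow_mul_rpow_neg_le_one hE hED hα
  unfold singleC
  rw [show -(α + 1) = -α - 1 by ring, rpow_sub_one hD.ne', ← mul_div_assoc,
    div_le_div_iff₀ (by positivity) (by positivity)]
  have h2 : b * D ^ (-α) ≤ k * (α * V) := by
    calc b * D ^ (-α) ≤ k * (α * V * E ^ α) * D ^ (-α) := by gcongr
      _ = k * (α * V) * (E ^ α * D ^ (-α)) := by ring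
      _ ≤ k * (α * V) * 1 := by gcongr
      _ = _ := mul_one _
  have h3 : b * (D ^ (-α) / D) * (2 * D) = 2 * (b * D ^ (-α)) := by field_simp
  rw [h3]
  have h4 : 0 ≤ k * V := by positivity
  nlinarith

lemma singleC_mul_doubleC_eq (hD : 0 < D) :
    singleC α D V * doubleC α D V =
      D ^ (-(2 * α + 1)) / (α * (α + 1) ^ 2 * V ^ 3) := by
  unfold singleC doubleC
  rw [show -(2 * α + 1) = -(α + 1) + -α by ring, rpow_add hD, div_mul_div_comm]
  congr 1
  ring

lemma doubleC_sq_eq (hD : 0 < D) :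
    doubleC α D V * doubleC α D V =
      D ^ (-(2 * α)) / (α ^ 2 * (α + 1) ^ 2 * V ^ 4) := by
  unfold doubleC
  rw [show -(2 * α) = -α + -α by ring, rpow_add hD, div_mul_div_comm]
  congr 1
  ring

lemma rpow_neg_three_quarters_le {p : ℝ} (hD : 0 < D) (hp : p ≤ 3) :
    (3 / 4 * D) ^ (-p) ≤ 64 / 27 * D ^ (-p) := by
  rw [mul_rpow (by norm_num) hD.le]
  gcongr
  calc (3 / 4 : ℝ) ^ (-p) ≤ (3 / 4 : ℝ) ^ (-3 : ℝ) :=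
        rpow_le_rpow_of_exponent_ge (by norm_num) (by norm_num) (by linarith)
    _ = 64 / 27 := by
        rw [rpow_neg (by norm_num)]
        norm_num

lemma velocity_constant_le {N β : ℝ} (hD : 0 < D) (hV : 0 < V) (hα : 0 < α) (hα1 : α ≤ 1)
    (hN : 2 ≤ N) :
    β ^ 2 * (8 * √N + 34) * (doubleC α (3 / 4 * D) V * singleC α (3 / 4 * D) V) ≤
      12 * N ^ 2 * β ^ 2 * (3 + 2 / V) ^ 2 / (α * (α + 1) * V ^ 2 * D ^ (2 * α + 1)) := by
  have h1 := rpow_neg_three_quarters_le (p := 2 * α + 1) hD (by linarith)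
  have hs : √N ≤ N := (sqrt_le_left (by linarith)).2 (by nlinarith)
  have h2 : 64 / 27 * (8 * √N + 34) ≤ 144 * N ^ 2 := by nlinarith
  have h3 : 12 / V ≤ (3 + 2 / V) ^ 2 := by
    have : (3 + 2 / V) ^ 2 = 9 + 12 / V + (2 / V) ^ 2 := by ring
    have := sq_nonneg (2 / V)
    linarith
  rw [mul_comm (doubleC _ _ _), singleC_mul_doubleC_eq (by positivity)]
  calc _ ≤ β ^ 2 * (8 * √N + 34) *
        ((64 / 27 * D ^ (-(2 * α + 1))) / (α * (α + 1) ^ 2 * V ^ 3)) := by gcongr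
    _ = β ^ 2 * (64 / 27 * (8 * √N + 34)) *
        (D ^ (-(2 * α + 1)) / (α * (α + 1) ^ 2 * V ^ 3)) := by ring
    _ ≤ β ^ 2 * (144 * N ^ 2) * (D ^ (-(2 * α + 1)) / (α * (α + 1) * V ^ 3)) := by
        gcongr
        nlinarith
    _ = 12 * N ^ 2 * β ^ 2 * (12 / V) / (α * (α + 1) * V ^ 2 * D ^ (2 * α + 1)) := by
        rw [rpow_neg hD.le]
        field_simp
        ring
    _ ≤ _ := by gcongr

lemma position_constant_le {N β : ℝ} (hD : 0 < D) (hV : 0 < V) (hα : 0 < α) (hα1 : α ≤ 1)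
    (hN : 2 ≤ N) :
    β ^ 2 * (8 * √N + 34) * (doubleC α (3 / 4 * D) V * doubleC α (3 / 4 * D) V) ≤
      24 * N ^ 2 * β ^ 2 * (3 + 1 / V) ^ 2 / (α ^ 2 * (α + 1) * V ^ 3 * D ^ (2 * α)) := by
  have h1 := rpow_neg_three_quarters_le (p := 2 * α) hD (by linarith)
  have hs : √N ≤ N := (sqrt_le_left (by linarith)).2 (by nlinarith)
  have h2 : 64 / 27 * (8 * √N + 34) ≤ 144 * N ^ 2 := by nlinarith
  have h3 : 6 / V ≤ (3 + 1 / V) ^ 2 := by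
    have : (3 + 1 / V) ^ 2 = 9 + 6 / V + (1 / V) ^ 2 := by ring
    have := sq_nonneg (1 / V)
    linarith
  rw [doubleC_sq_eq (by positivity)]
  calc _ ≤ β ^ 2 * (8 * √N + 34) *
        ((64 / 27 * D ^ (-(2 * α))) / (α ^ 2 * (α + 1) ^ 2 * V ^ 4)) := by gcongr
    _ = β ^ 2 * (64 / 27 * (8 * √N + 34)) *
        (D ^ (-(2 * α)) / (α ^ 2 * (α + 1) ^ 2 * V ^ 4)) := by ring
    _ ≤ β ^ 2 * (144 * N ^ 2) * (D ^ (-(2 * α)) / (α ^ 2 * (α + 1) * V ^ 4)) := by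
        gcongr
        nlinarith
    _ = 24 * N ^ 2 * β ^ 2 * (6 / V) / (α ^ 2 * (α + 1) * V ^ 3 * D ^ (2 * α)) := by
        rw [rpow_neg hD.le]
        field_simp
        ring
    _ ≤ _ := by gcongr

/-- The drift speed allowed by the definition of the free solutions is a small part of the
energy. -/
lemma drift_le {N b m s A A' : ℝ} (hN : 2 ≤ N) (hb : 0 ≤ b) (hbm : b ≤ m) (hs : 0 < s)
    (hα : 0 < α) (hA : 0 < A) (hA' : 3 / 4 * A ≤ A') (hμ : 32 * N * m ≤ α * s ^ 2 * A) :
    4 * √2 * √N * b / (α * s * A') ≤ s / 6 := by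
  have hNs : √N * √N = N := mul_self_sqrt (by linarith)
  have h2s : √2 * √2 = 2 := mul_self_sqrt (by norm_num)
  have h2N : √2 ≤ √N := sqrt_le_sqrt hN
  have h1 : √2 * √N ≤ N := by nlinarith [sqrt_nonneg N]
  have hA'' : 0 < A' := by linarith
  rw [div_le_iff₀ (by positivity)]
  calc 4 * √2 * √N * b = 4 * (√2 * √N) * b := by ring
    _ ≤ 4 * N * m := by gcongr
    _ ≤ α * s ^ 2 * A / 8 := by linarith
    _ = α * s ^ 2 * (3 / 4 * A) / 6 := by ring
    _ ≤ α * s ^ 2 * A' / 6 := by gcongr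
    _ = s / 6 * (α * s * A') := by ring

end Constants

section Main

lemma Tube.mono {Fl Fs : Euc n → Euc n} {α D V bl1 bl2 bs2 bs3 K c c' : ℝ} {γ : ℝ → Euc n}
    (T : Tube Fl Fs α D V bl1 bl2 bs2 bs3 K c' γ) (h : c ≤ c') :
    Tube Fl Fs α D V bl1 bl2 bs2 bs3 K c γ :=
  ⟨fun t a ha => T.long_bound t a (by linarith), fun t a ha => T.short_bound t a (by linarith),
    fun t a b ha hb => T.long_lipschitz t a b (by linarith) (by linarith),
    fun t a b ha hb => T.short_lipschitz t a b (by linarith) (by linarith)⟩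

lemma three_quarters_mul_rpow_le {a b α : ℝ} (ha : 0 < a) (hα : 0 < α) (hα1 : α ≤ 1)
    (h : 3 / 4 * a ≤ b) : 3 / 4 * a ^ α ≤ b ^ α := by
  calc 3 / 4 * a ^ α ≤ (3 / 4 : ℝ) ^ α * a ^ α := by
        gcongr
        simpa using rpow_le_rpow_of_exponent_ge (x := 3 / 4) (by norm_num) (by norm_num) hα1
    _ = (3 / 4 * a) ^ α := (mul_rpow (by norm_num) ha.le).symm
    _ ≤ b ^ α := by gcongr

set_option maxHeartbeats 2000000 in
/-- The asymptotic estimates, with the powers of `2` written through `√2`. -/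
theorem scattering_asymptotics (hn : 2 ≤ n) {α : ℝ} (hα0 : 0 < α) (hα1 : α ≤ 1)
    {Vl Vs : Euc n → ℝ} {βl0 βl1 βl2 βs1 βs2 βs3 : ℝ}
    (hβl1 : 0 < βl1) (hβl2 : 0 < βl2) (hβs2 : 0 < βs2) (hβs3 : 0 < βs3)
    (hVl : LongRange α βl0 βl1 βl2 Vl) (hVs : ShortRange α βs1 βs2 βs3 Vs)
    {Fl Fs F : Euc n → Euc n}
    (hFl : ∀ y, Fl y = -gradient Vl y) (hFs : ∀ y, Fs y = -gradient Vs y)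
    (hF : ∀ y, F y = Fl y + Fs y)
    {θ x : Euc n} (hθ : ‖θ‖ = 1) (hperp : ⟪θ, x⟫ = 0)
    {r V s ξ : ℝ} (hξ : ξ = ‖x‖ / √2) (hr0 : 0 < r) (hr : r < 1 / 2 + ξ / 2) (hV : 0 < V)
    (hs : s = 2 * √2 * (V + r))
    (hμ : 32 * n * max βl1 βl2 ≤ α * s ^ 2 * (1 + ξ) ^ α)
    (hcond1 : 20 * (n : ℝ) * max βl1 (max βl2 βs2) ≤ α * V ^ 2 * (1 / 2 + ξ / 2 - r) ^ α)
    (hcond2 : 12 * (max βl1 (max (max βl2 βs2) βs3)) * (n : ℝ) * (1 + 1 / V) ^ 2 ≤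
      α * r * V * (1 / 2 + ξ / 2 - r) ^ α)
    {zm : ℝ → Euc n}
    (hzm : IsFreeSol Fl x (s • θ) atBot (4 * √2 * √n * βl1 / (α * s * (1 + ξ) ^ α)) zm) :
    (∃! y : ℝ → Euc n, MemM r y ∧ Aop Fl F zm 0 y = y) ∧
    ∀ ym : ℝ → Euc n, MemM r ym → Aop Fl F zm 0 ym = ym →
      ∀ zp : Euc n → ℝ → Euc n,
        (∀ h : Euc n, ‖h‖ ≤ 1 / 4 + ξ / 4 →
          IsFreeSol Fl (x + h) (s • θ + ∫ τ : ℝ, F (zm τ + ym τ)) atTop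
            (4 * √2 * √n * βl1 / (α * s * (1 + ξ - ‖h‖) ^ α)) (zp h)) →
        ∀ bsc : Euc n, ‖bsc‖ ≤ 1 / 4 + ξ / 4 → Gmap Fl Fs F zm zp ym bsc = bsc →
          ‖(∫ τ : ℝ, F (zm τ + ym τ)) - Wtilde Fl zm (zp 0) - ∫ τ : ℝ, Fs (τ • (s • θ) + x)‖ ≤
              12 * (n : ℝ) ^ 2 * (max βl1 (max (max βl2 βs2) βs3)) ^ 2 * (3 + 2 / V) ^ 2 /
                (α * (α + 1) * V ^ 2 * (1 - r + ξ) ^ (2 * α + 1)) ∧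
            ‖bsc - (∫ σ in Iic (0:ℝ), ∫ τ in Iic σ, Fs (τ • (s • θ) + x)) +
                ∫ σ in Ici (0:ℝ), ∫ τ in Ici σ, Fs (τ • (s • θ) + x)‖ ≤
              24 * (n : ℝ) ^ 2 * (max βl1 (max (max βl2 βs2) βs3)) ^ 2 * (3 + 1 / V) ^ 2 /
                (α ^ 2 * (α + 1) * V ^ 3 * (1 - r + ξ) ^ (2 * α)) := by
  have hN : (2 : ℝ) ≤ n := by exact_mod_cast hn
  have hξ0 : 0 ≤ ξ := by rw [hξ]; positivity
  have h2 : √2 * √2 = 2 := mul_self_sqrt (by norm_num)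
  have h2l : (1.41 : ℝ) ≤ √2 := le_sqrt_of_sq_le (by norm_num)
  have h2u : √2 ≤ 1.42 := (sqrt_le_left (by norm_num)).2 (by norm_num)
  set E := 1 / 2 + ξ / 2 - r with hE_def
  set D₀ := 1 - r + ξ with hD₀_def
  set D := 3 / 4 * D₀ with hD_def
  have hE : 0 < E := by linarith
  have hD₀ : 0 < D₀ := by linarith
  have hD : 0 < D := by positivity
  have hED : E ≤ D := by linarith
  have hD38 : 3 / 8 ≤ D := by linarith
  have hrD : 3 / 4 * r ≤ D := by linarith
  have hs0 : 0 < s := by rw [hs]; positivity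
  have hsV : 2.82 * (V + r) ≤ s := by 
    have := mul_le_mul_of_nonneg_right h2l (by positivity : 0 ≤ V + r)
    linarith
  set β' := max βl1 (max βl2 βs2) with hβ'
  set β := max βl1 (max (max βl2 βs2) βs3) with hβ
  have l1β' : βl1 ≤ β' := le_max_left _ _
  have l2β' : βl2 ≤ β' := (le_max_left _ _).trans (le_max_right _ _)
  have s2β' : βs2 ≤ β' := (le_max_right _ _).trans (le_max_right _ _)
  have l1β : βl1 ≤ β := le_max_left _ _
  have l2β : βl2 ≤ β := ((le_max_left _ _).trans (le_max_left _ _)).trans (le_max_right _ _)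
  have s2β : βs2 ≤ β := ((le_max_right _ _).trans (le_max_left _ _)).trans (le_max_right _ _)
  have s3β : βs3 ≤ β := (le_max_right _ _).trans (le_max_right _ _)
  have hβ'0 : 0 < β' := hβl1.trans_le l1β'
  have hβ0 : 0 < β := hβl1.trans_le l1β
  have hP := doubleC_pos hD hV hα0
  have hS := singleC_pos hD hV hα0
  have hR := linearC_pos hD hV hα0
  have hRP : linearC α D V = (α + 1) * doubleC α D V := linearC_eq hV hα0
  have hSP : singleC α D V = α * V * doubleC α D V / D := singleC_eq hD hV hα0
  have hR40 : β' * linearC α D V ≤ 1 / 40 := by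
    refine mul_linearC_le_of_le hE hED hα0 hV (by norm_num) ?_
    have : 20 * 2 * β' ≤ 20 * n * β' := by gcongr
    linarith
  have hc2 : β * (1 + 1 / V) ^ 2 ≤ r / 24 * (α * V * E ^ α) := by
    have h0 : 0 ≤ β * (1 + 1 / V) ^ 2 := by positivity
    have := mul_le_mul_of_nonneg_right hN h0
    linarith
  have hEα : 0 < E ^ α := by positivity
  have hR96 : β * linearC α D V ≤ r / 96 := by
    refine mul_linearC_le_of_le hE hED hα0 hV (by positivity) ?_
    have h1 : 4 / V ≤ (1 + 1 / V) ^ 2 := by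
      have := sq_nonneg (1 - 1 / V)
      have e1 : (1 + 1 / V) ^ 2 = (1 - 1 / V) ^ 2 + 4 / V := by ring
      linarith
    have h3 : β * (4 / V) ≤ r / 24 * (α * V * E ^ α) :=
      (mul_le_mul_of_nonneg_left h1 hβ0.le).trans hc2
    rw [← mul_div_assoc, div_le_iff₀ hV] at h3
    linarith
  have hSD : β * singleC α D V ≤ r / 24 / (2 * D) := by
    refine mul_singleC_le_of_le hE hED hα0 hα1 hV (by positivity) ?_
    refine le_trans (le_mul_of_one_le_right hβ0.le ?_) hc2
    have : 0 < 1 / V := by positivity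
    exact one_le_pow₀ (by linarith)
  have hS36 : β * singleC α D V ≤ 1 / 36 := by
    refine hSD.trans ?_
    rw [div_le_iff₀ (by positivity)]
    linarith
  have hS18 : β * singleC α D V ≤ r / 18 := by
    refine hSD.trans ?_
    rw [div_le_iff₀ (by positivity)]
    have := mul_le_mul_of_nonneg_left hD38 hr0.le
    linarith
  have hαP := mul_pos hα0 hP
  have hαP1 := mul_le_mul_of_nonneg_right hα1 hP.le
  have hPR : doubleC α D V ≤ linearC α D V := by rw [hRP]; linarith
  have hRP2 : linearC α D V ≤ 2 * doubleC α D V := by rw [hRP]; linarith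
  have wk : ∀ {a b q k : ℝ}, 0 < q → a ≤ b → b * q ≤ k → a * q ≤ k := fun hq h h' =>
    (mul_le_mul_of_nonneg_right h hq.le).trans h'
  -- the tube around the free motion
  set γ : ℝ → Euc n := fun t => t • (s • θ) + x with hγ_def
  have cγ : Continuous γ := by fun_prop
  have hvx : ⟪s • θ, x⟫ = 0 := by rw [inner_smul_left, hperp, mul_zero]
  have hns : ‖s • θ‖ = s := by rw [norm_smul, hθ, mul_one, norm_of_nonneg hs0.le]
  set H := 1 / 4 + ξ / 4 with hH_def
  set c := max r H with hc_def
  have hc0 : 0 ≤ c := hr0.le.trans (le_max_left _ _)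
  have hK0 : 0 ≤ s / 4 + r := by positivity
  have T : Tube Fl Fs α D V βl1 βl2 βs2 βs3 (s / 4 + r) c γ := by
    refine tube_of_decay hα0 hβl1 hβl2 hβs2 hβs3 hVl hVs hFl hFs hD hV fun t a ha => ?_
    have h1 := norm_free_motion_ge hvx ha
    rw [hns, ← hξ] at h1
    have h3 : c ≤ 1 + ξ - D := max_le (by linarith) (by linarith)
    have h4 : (V + (s / 4 + r)) * |t| ≤ s * |t| / √2 := by
      rw [le_div_iff₀ (by positivity)]
      have : (V + (s / 4 + r)) * √2 ≤ s := by
        have e : (V + (s / 4 + r)) * √2 = s / 2 + s / 4 * √2 := by rw [hs]; ring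
        rw [e]
        have := mul_le_mul_of_nonneg_left h2u hs0.le
        linarith
      have := mul_le_mul_of_nonneg_right this (abs_nonneg t)
      linarith
    linarith
  have Tr := T.mono (le_max_left r H)
  have cFl : Continuous Fl := by
    rw [show Fl = fun y => -gradient Vl y from funext hFl]
    exact (continuous_gradient hVl.1).neg
  have cFs : Continuous Fs := by
    rw [show Fs = fun y => -gradient Vs y from funext hFs]
    exact (continuous_gradient hVs.1).neg
  have cF : Continuous F := by
    rw [show F = fun y => Fl y + Fs y from funext hF]; exact cFl.add cFs
  have czm := hzm.1.continuous
  have hξ1 : 0 < 1 + ξ := by positivity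
  set C := 4 * √2 * √n * βl1 / (α * s * (1 + ξ) ^ α) with hC_def
  have hC0 : 0 ≤ C := by positivity
  have hC6 : C ≤ s / 6 := by
    have : 0 < (1 + ξ) ^ α := by positivity
    exact drift_le hN hβl1.le (le_max_left βl1 βl2) hs0 hα0 this (by linarith) hμ
  have hzmC : ∀ t, ‖zm t - γ t‖ ≤ C * |t| := fun t => by
    have := hzm.2.2.2.2 t
    rwa [show zm t - γ t = zm t - x - t • s • θ by simp only [hγ_def]; abel]
  have hzmκ : ∀ t, ‖zm t - γ t‖ ≤ s / 4 * |t| := fun t =>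
    (hzmC t).trans (mul_le_mul_of_nonneg_right (by linarith) (abs_nonneg t))
  refine ⟨?_, fun ym hym hA zp hzp bsc hbsc hG => ?_⟩
  · refine existsUnique_aop_fixedPoint hD hV hα0 hβl2.le hβs3.le hr0.le cFl cF hF Tr czm hzmκ
      ?_ ?_
    · have e1 := wk hP l2β' ((mul_le_mul_of_nonneg_left hPR hβ'0.le).trans hR40)
      have e2 := wk hP s2β ((mul_le_mul_of_nonneg_left hPR hβ0.le).trans hR96)
      have e3 := wk hS s2β hS18
      have e4 := wk hS l2β hS36
      have e5 := wk hR l2β' hR40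
      have e6 := mul_le_mul_of_nonneg_right e1 hr0.le
      have e7 := mul_le_mul_of_nonneg_right e4 hr0.le
      have e8 := mul_le_mul_of_nonneg_right e5 hr0.le
      linarith
    · have e5 := wk hR l2β' hR40
      have e4 := wk hS l2β hS36
      have f1 : βs3 / D * linearC α D V ≤ 1 / 72 := by
        rw [div_mul_eq_mul_div, div_le_iff₀ hD]
        exact (wk hR s3β hR96).trans (by linarith)
      have f2 : βs3 / D * singleC α D V ≤ 2 / 27 := by
        rw [div_mul_eq_mul_div, div_le_iff₀ hD]
        exact (wk hS s3β hS36).trans (by linarith)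
      have hL : 0 ≤ βl2 + βs3 / D := by positivity
      have := mul_le_mul_of_nonneg_left hPR hL
      linarith
  have hR40l := wk hR l2β' hR40
  have hP40l : βl2 * doubleC α D V ≤ 1 / 40 :=
    (mul_le_mul_of_nonneg_left hPR hβl2.le).trans hR40l
  obtain ⟨y0, y1⟩ := fixedPoint_bounds hD hV hα0 hβl2.le hβs2.le hr0.le cFl cF hF Tr czm hzmκ
    hP40l hR40l hym hA
  set z : ℝ → Euc n := fun t => zm t + ym t with hz_def
  have cz : Continuous z := czm.add hym.1
  have tz : ∀ t, ‖z t - γ t‖ ≤ (s / 4 + r) * |t| + c := fun t =>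
    (hym.mem_tube hzmκ t).trans (by linarith [le_max_left r H])
  have tzm : ∀ t, ‖zm t - γ t‖ ≤ (s / 4 + r) * |t| + c := fun t =>
    (mem_tube_base hr0.le hzmκ t).trans (by linarith [le_max_left r H])
  have hzd : ∀ t, HasDerivAt (fun t => z t - zm t) (∫ τ in Iic t, (F (z τ) - Fl (zm τ))) t := by
    have h1 := (aop_bounds hD hV hα0 hβl2.le hr0.le cFl cF hF Tr czm hzmκ hym hr0.le
      (fun t ht => hym.norm_le_of_nonpos ht) (fun t ht => (hym.norm_le_of_nonneg ht).trans_eq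
        (by ring : r * (1 + t) = r + r * t))).1
    rw [hA] at h1
    have e : (fun t => z t - zm t) = ym := by funext t; simp [hz_def]
    rw [e]
    exact h1
  -- free outgoing solutions stay in the tube
  have hforce : ‖∫ τ, F (z τ)‖ ≤ 0.1167 * V := by
    refine (integrableOn_force hD hV hα0 cFl cFs hF T cz tz).2.2.trans ?_
    have e1 : D ^ (-α) / (α * V) = V * linearC α D V := by
      unfold linearC; field_simp
    have e2 : βs2 * singleC α D V ≤ V / 30 := by
      rw [hSP, ← mul_div_assoc, div_le_iff₀ hD]
      have h3 : α * doubleC α D V ≤ linearC α D V / 2 := by rw [hRP]; linarith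
      have h4 := wk hR s2β' hR40
      have h5 := mul_le_mul_of_nonneg_left h3 (mul_pos hβs2 hV).le
      have h6 := mul_le_mul_of_nonneg_right h4 hV.le
      have h7 := mul_le_mul_of_nonneg_left hD38 hV.le
      linarith
    rw [e1]
    have h4 := mul_le_mul_of_nonneg_right (wk hR l1β' hR40) hV.le
    linarith
  have tzp : ∀ h, ‖h‖ ≤ H → ∀ t, 0 ≤ t → ‖zp h t - γ t‖ ≤ (s / 4 + r) * |t| + c := by
    intro h hh t ht
    have h1 := (hzp h hh).2.2.2.2 t
    have hdr := drift_le (A' := (1 + ξ - ‖h‖) ^ α) hN hβl1.le (le_max_left βl1 βl2) hs0 hα0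
      (by positivity) (three_quarters_mul_rpow_le hξ1 hα0 hα1 (by linarith)) hμ
    have h3 : zp h t - γ t = (zp h t - (x + h) - t • (s • θ + ∫ τ, F (z τ))) +
        (h + t • ∫ τ, F (z τ)) := by
      simp only [hγ_def, smul_add]; abel
    rw [h3, abs_of_nonneg ht]
    rw [abs_of_nonneg ht] at h1
    have h4 := norm_add_le (zp h t - (x + h) - t • (s • θ + ∫ τ, F (z τ)))
      (h + t • ∫ τ, F (z τ))
    have h5 := norm_add_le h (t • ∫ τ, F (z τ))
    rw [norm_smul, norm_of_nonneg ht] at h5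
    have h6 := mul_le_mul_of_nonneg_right hdr ht
    have h7 : ‖∫ τ, F (z τ)‖ ≤ s / 12 + r := by linarith
    have h8 := mul_le_mul_of_nonneg_left h7 ht
    have h9 := le_max_right r H
    linarith
  have hH0 : 0 ≤ H := by positivity
  have hdiff : ∀ h, ‖h‖ ≤ H → ∀ t, 0 ≤ t → ‖z t - zp h t‖ ≤
      20 / 19 * (‖ym 0 - h‖ + βs2 * doubleC α D V) := by
    intro h hh t ht
    have := norm_scattering_difference_le hD hV hα0 hK0 hc0 hβl2.le hβs2.le (by linarith) cFl cFs
      hF T hzm tzm cz tz hzd (hzp h hh) (tzp h hh) ht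
    have e : z 0 - (x + h) = ym 0 - h := by
      simp only [hz_def, hzm.2.2.1]; abel
    rwa [e] at this
  have hym0 := y0 0 le_rfl
  set P := doubleC α D V with hP_def
  set S := singleC α D V with hS_def
  have hβP : βs2 * P ≤ β * P := by gcongr
  have hY : ∀ t ≤ 0, ‖z t - zm t‖ ≤ 2 * (β * P) := fun t ht => by
    have := y0 t ht
    rw [show z t - zm t = ym t by simp [hz_def]]
    linarith
  have hS8 : S / V ≤ 8 / 3 * P := by
    rw [hSP, div_div, div_le_iff₀ (by positivity)]
    have : α * (V * P) ≤ 1 * (V * P) := by gcongr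
    have h8 := mul_le_mul_of_nonneg_left hD38 (mul_pos hV hP).le
    linarith
  have hCV : C ≤ 4 * √n * (β * P) * V := by
    have e1 : 2 * √n * (β * linearC α D V) * V = 2 * √n * β * D ^ (-α) / (α * V) := by
      unfold linearC; field_simp
    have e2 : C ≤ 2 * √n * β * D ^ (-α) / (α * V) := by
      rw [rpow_neg hD.le, ← div_eq_mul_inv, div_div]
      calc C ≤ 4 * √2 * √n * β / (α * (2 * √2 * V) * D ^ α) := by
            rw [hC_def]
            gcongr
            · rw [hs]; gcongr; linarith
            · linarith
        _ = _ := by field_simp; norm_num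
    rw [← e1] at e2
    refine e2.trans ?_
    have := mul_le_mul_of_nonneg_left hRP2 (by positivity : 0 ≤ 2 * √n * β * V)
    linarith
  have he : ∀ t, ‖z t - γ t‖ ≤ (4 * √n + 14) * (β * P) * (D + V * |t|) := by
    intro t
    have h1 : ‖ym t‖ ≤ 2 * (β * P) + 8 * (β * P) * (V * |t|) := by
      rcases le_total t 0 with ht | ht
      · have := y0 t ht
        have : 0 ≤ 8 * (β * P) * (V * |t|) := by positivity
        linarith
      · have h3 := y1 t ht
        rw [abs_of_nonneg ht]
        have h4 : βs2 * S ≤ β * (8 / 3 * P * V) := by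
          rw [div_le_iff₀ hV] at hS8
          gcongr
        have h5 := mul_le_mul_of_nonneg_right h4 ht
        linarith
    have h3 := hzmC t
    have h4 := mul_le_mul_of_nonneg_right hCV (abs_nonneg t)
    have h5 := norm_add_le (zm t - γ t) (ym t)
    have h6 : z t - γ t = zm t - γ t + ym t := by simp only [hz_def]; abel
    rw [h6]
    have hβP0 : 0 ≤ β * P := by positivity
    have h7 := mul_le_mul_of_nonneg_left hD38 hβP0
    have h8 : 0 ≤ 4 * √n * (β * P) * D := by positivity
    have h9 : 0 ≤ β * P * (V * |t|) := by positivity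
    linarith
  -- conclusion
  have hfin : ∀ B, B ≤ 3.2 * (β * P) → ∀ q, 0 < q →
      (2 * βs3 * ((4 * √n + 14) * (β * P)) + βl2 * (2 * (β * P) + B)) * q ≤
        β ^ 2 * (8 * √n + 34) * (P * q) := by
    intro B hB q hq
    have hβP0 : 0 ≤ β * P := by positivity
    have h1 : 2 * βs3 * ((4 * √n + 14) * (β * P)) ≤ 2 * β * ((4 * √n + 14) * (β * P)) := by gcongr
    have h3 : βl2 * (2 * (β * P) + B) ≤ β * (6 * (β * P)) :=
      (mul_le_mul_of_nonneg_left (by linarith) hβl2.le).trans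
        (mul_le_mul_of_nonneg_right l2β (by positivity))
    calc _ ≤ (2 * β * ((4 * √n + 14) * (β * P)) + β * (6 * (β * P))) * q := by gcongr
      _ = _ := by ring
  have h0H : ‖(0 : Euc n)‖ ≤ H := by rw [norm_zero]; exact hH0
  constructor
  · refine (norm_velocity_remainder_le hD hV hα0 hK0 hc0 hβl2.le hβs3.le cFl cFs hF T cγ czm
      (hzp 0 h0H).1.continuous cz tzm tz (tzp 0 h0H) he hY (hdiff 0 h0H)).trans ?_
    refine (hfin _ ?_ S hS).trans (velocity_constant_le hD₀ hV hα0 hα1 hN)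
    rw [sub_zero]
    have : 0 ≤ β * P := by positivity
    linarith
  · have hG' : bsc = ym 0 - (∫ σ in Ici (0 : ℝ), ∫ τ in Ici σ, Fs (z τ)) -
        ∫ σ in Ici (0 : ℝ), ∫ τ in Ici σ, (Fl (z τ) - Fl (zp bsc τ)) := by
      have h1 := congrFun hA 0
      simp only [Aop] at h1
      rw [← h1]
      simpa only [Gmap, lInt, add_zero] using hG.symm
    have hsmall := norm_sub_position_le hD hV hα0 hβl2.le cFl cFs T (hzp bsc hbsc).1.continuous cz tz
      (tzp bsc hbsc) (hdiff bsc hbsc) hG'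
    have hsm : ‖ym 0 - bsc‖ ≤ 1.1 * (βs2 * P) := by
      have h1 : 0 ≤ 20 / 19 * (‖ym 0 - bsc‖ + βs2 * P) := by positivity
      have := mul_le_mul_of_nonneg_right hP40l h1
      linarith
    have hG'' : bsc = (∫ σ in Iic (0 : ℝ), ∫ τ in Iic σ, (F (z τ) - Fl (zm τ))) -
        (∫ σ in Ici (0 : ℝ), ∫ τ in Ici σ, Fs (z τ)) -
        ∫ σ in Ici (0 : ℝ), ∫ τ in Ici σ, (Fl (z τ) - Fl (zp bsc τ)) := by
      simpa only [Gmap, lInt, add_zero] using hG.symm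
    refine (norm_position_remainder_le hD hV hα0 hK0 hc0 hβl2.le hβs3.le cFl cFs hF T cγ czm
      (hzp bsc hbsc).1.continuous cz tzm tz (tzp bsc hbsc) he hY (hdiff bsc hbsc) hG'').trans ?_
    refine (hfin _ ?_ P hP).trans (position_constant_le hD₀ hV hα0 hα1 hN)
    have : 0 ≤ βs2 * P := by positivity
    linarith

end Main

theorem statement_19
    (n : ℕ) (hn : 2 ≤ n) (α : ℝ) (hα0 : 0 < α) (hα1 : α ≤ 1)
    (Vl Vs : Euc n → ℝ) (βl0 βl1 βl2 βs1 βs2 βs3 : ℝ)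
    (hβl0 : 0 < βl0) (hβl1 : 0 < βl1) (hβl2 : 0 < βl2)
    (hβs1 : 0 < βs1) (hβs2 : 0 < βs2) (hβs3 : 0 < βs3)
    (hVl : LongRange α βl0 βl1 βl2 Vl) (hVs : ShortRange α βs1 βs2 βs3 Vs)
    (Fl Fs F : Euc n → Euc n)
    (hFl : ∀ y, Fl y = -gradient Vl y) (hFs : ∀ y, Fs y = -gradient Vs y)
    (hF : ∀ y, F y = Fl y + Fs y)
    (θ x : Euc n) (hθ : ‖θ‖ = 1) (hperp : ⟪θ, x⟫ = 0)
    (r : ℝ) (hr0 : 0 < r) (hr : r < 1 / 2 + ‖x‖ / 2 ^ ((3:ℝ)/2))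
    (s : ℝ) (hsμ : Real.sqrt (2 ^ 5 * (n : ℝ) * max βl1 βl2 / (α * (1 + ‖x‖ / Real.sqrt 2) ^ α)) ≤ s) (hsr : 2 ^ ((3:ℝ)/2) * r < s)
    (hcond1 : 20 * (n : ℝ) * max βl1 (max βl2 βs2) ≤
      α * (s / (2 * Real.sqrt 2) - r) ^ 2 * (1 / 2 + ‖x‖ / (2 * Real.sqrt 2) - r) ^ α)
    (hcond2 : 12 * (max βl1 (max (max βl2 βs2) βs3)) * (n : ℝ) * (1 + 1 / (s / 2 ^ ((3:ℝ)/2) - r)) ^ 2 ≤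
      α * r * (s / 2 ^ ((3:ℝ)/2) - r) * (1 / 2 - r + ‖x‖ / 2 ^ ((3:ℝ)/2)) ^ α)
    (zm : ℝ → Euc n)
    (hzm : IsFreeSol Fl x (s • θ) atBot
      (2 ^ ((5:ℝ)/2) * Real.sqrt n * βl1 /
        (α * s * (1 + ‖x‖ / Real.sqrt 2) ^ α)) zm) :
    (∃! y : ℝ → Euc n, MemM r y ∧ Aop Fl F zm 0 y = y) ∧
    ∀ ym : ℝ → Euc n, MemM r ym → Aop Fl F zm 0 ym = ym →
      ∀ zp : Euc n → ℝ → Euc n,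
        (∀ h : Euc n, ‖h‖ ≤ 1 / 4 + ‖x‖ / 2 ^ ((5:ℝ)/2) →
          IsFreeSol Fl (x + h) (s • θ + ∫ τ : ℝ, F (zm τ + ym τ)) atTop
            (2 ^ ((5:ℝ)/2) * Real.sqrt n * βl1 /
              (α * s * (1 + ‖x‖ / Real.sqrt 2 - ‖h‖) ^ α)) (zp h)) →
        ∀ bsc : Euc n,
          bsc ∈ Metric.closedBall (0 : Euc n) (1 / 4 + ‖x‖ / 2 ^ ((5:ℝ)/2)) →
          Gmap Fl Fs F zm zp ym bsc = bsc →
          ‖(∫ τ : ℝ, F (zm τ + ym τ)) - Wtilde Fl zm (zp 0) - ∫ τ : ℝ, Fs (τ • (s • θ) + x)‖ ≤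
              12 * (n : ℝ) ^ 2 * (max βl1 (max (max βl2 βs2) βs3)) ^ 2 * (3 + 2 / (s / 2 ^ ((3:ℝ)/2) - r)) ^ 2 /
                (α * (α + 1) * (s / 2 ^ ((3:ℝ)/2) - r) ^ 2 * (1 - r + ‖x‖ / Real.sqrt 2) ^ (2 * α + 1)) ∧
            ‖bsc - (∫ σ in Iic (0:ℝ), ∫ τ in Iic σ, Fs (τ • (s • θ) + x)) +
                ∫ σ in Ici (0:ℝ), ∫ τ in Ici σ, Fs (τ • (s • θ) + x)‖ ≤
              24 * (n : ℝ) ^ 2 * (max βl1 (max (max βl2 βs2) βs3)) ^ 2 * (3 + 1 / (s / 2 ^ ((3:ℝ)/2) - r)) ^ 2 /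
                (α ^ 2 * (α + 1) * (s / 2 ^ ((3:ℝ)/2) - r) ^ 3 * (1 - r + ‖x‖ / Real.sqrt 2) ^ (2 * α)) := by
  have h2 : √2 * √2 = 2 := mul_self_sqrt (by norm_num)
  have h2p : 0 < √2 := by positivity
  have e3 : (2 : ℝ) ^ ((3 : ℝ) / 2) = 2 * √2 := by
    rw [show (3 : ℝ) / 2 = 1 + 1 / 2 by norm_num, rpow_add two_pos, rpow_one, ← sqrt_eq_rpow]
  have e5 : (2 : ℝ) ^ ((5 : ℝ) / 2) = 4 * √2 := by
    rw [show (5 : ℝ) / 2 = 2 + 1 / 2 by norm_num, rpow_add two_pos, ← sqrt_eq_rpow]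
    norm_num
  have x3 : ‖x‖ / (2 * √2) = ‖x‖ / √2 / 2 := by rw [div_div, mul_comm]
  have x5 : ‖x‖ / (4 * √2) = ‖x‖ / √2 / 4 := by rw [div_div, mul_comm]
  rw [e3] at hr hsr hcond2
  rw [e5] at hzm
  simp only [e3, e5]
  rw [x3] at hr hcond1 hcond2
  simp only [x5, mem_closedBall_zero_iff]
  obtain ⟨V, hVdef⟩ : ∃ V, V = s / (2 * √2) - r := ⟨_, rfl⟩
  rw [← hVdef] at hcond1 hcond2 ⊢
  have hV : 0 < V := by
    rw [hVdef, sub_pos, lt_div_iff₀ (by positivity), mul_comm]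
    exact hsr
  have hs : s = 2 * √2 * (V + r) := by
    rw [hVdef]
    field_simp
    ring
  have hμ : 32 * (n : ℝ) * max βl1 βl2 ≤ α * s ^ 2 * (1 + ‖x‖ / √2) ^ α := by
    have h := (sqrt_le_left (by rw [hs]; positivity)).1 hsμ
    rw [div_le_iff₀ (by positivity)] at h
    linarith
  exact scattering_asymptotics hn hα0 hα1 hβl1 hβl2 hβs2 hβs3 hVl hVs hFl hFs hF hθ hperp rfl hr0
    hr hV hs hμ hcond1 (by rwa [show 1 / 2 - r + ‖x‖ / √2 / 2 = 1 / 2 + ‖x‖ / √2 / 2 - r by ring]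
      at hcond2) hzm

end Paper
end
end
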